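/- arXiv:0810.0392 — 2 statements merged into one kernel-verified Lean document; each statement's English description precedes it below -/
import Mathlib

section
/- Suppose β ∈ [0,1] and p ≥ 1/2, and fix any initial configuration ξ₀ = S₀ ∈ 𝒟. Then for every ε > 0, Pr_{β,p}-almost surely, for all but finitely many t ∈ ℤ⁺, max_{0 ≤ s ≤ t} |ξ_s| ≤ t^{1/2}(log t)^{(1/2)+ε}. -/
open MeasureTheory Filter
open scoped ENNReal NNReal

namespace EV

/-- A configuration of the exclusion-voter model is the finite hybrid-zone word
(`false` = 0, `true` = 1); the full two-sided configuration is `1^∞ w 0^∞`. -/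
abbrev Word := List Bool

/-- Canonical (normalized) words: empty (the ground state `𝒟₀`) or starting with
a `0` and ending with a `1`; these are in bijection with the configuration space `𝒟`. -/
def IsConfig (w : Word) : Prop :=
  w = [] ∨ (w.head? = some false ∧ w.getLast? = some true)

/-- The ground-state Heaviside configuration `𝒟₀ = …111000…`. -/
def groundState : Word := []

/-- Pad a word with one boundary symbol of the adjacent infinite block on each side. -/
def pad (w : Word) : Word := true :: (w ++ [false])

/-- Normalize: strip leading `1`s (they merge into the left infinite block of `1`s)
and trailing `0`s (they merge into the right infinite block of `0`s). -/
def strip (w : Word) : Word :=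
  ((w.dropWhile (· = true)).reverse.dropWhile (· = false)).reverse

def setPair (w : Word) (i : ℕ) (a b : Bool) : Word := (w.set i a).set (i + 1) b

def swapPair (w : Word) (i : ℕ) : Word :=
  setPair w i (w.getD (i + 1) true) (w.getD i true)

/-- Indices of the unlike adjacent pairs (`01` or `10`), read off the padded word. -/
def unlike (w : Word) : List ℕ :=
  (List.range (w.length + 1)).filter
    (fun i => (pad w).getD i true ≠ (pad w).getD (i + 1) true)

/-- One-step transition kernel of the discrete-time exclusion-voter chain with mixing
parameter `β` and exclusion parameter `p`: an unlike adjacent pair is chosen uniformly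
at random; with probability `β` a voter move flips the pair to `00` or `11` (each with
probability `1/2`); with probability `1-β` an exclusion move swaps a `01` with
probability `p` and a `10` with probability `1-p` (otherwise no change). -/
noncomputable def P (β p : ℝ) (w w' : Word) : ℝ :=
  ((unlike w).map (fun i =>
    let a := (pad w).getD i true
    let swapProb := if a then 1 - p else p
    ((unlike w).length : ℝ)⁻¹ *
      (β * (1 / 2) * (if strip (setPair (pad w) i false false) = w' then 1 else 0)
       + β * (1 / 2) * (if strip (setPair (pad w) i true true) = w' then 1 else 0)
       + (1 - β) * swapProb * (if strip (swapPair (pad w) i) = w' then 1 else 0)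
       + (1 - β) * (1 - swapProb) * (if w = w' then 1 else 0)))).sum

/-- `n`-step transition probabilities. -/
noncomputable def Pn (β p : ℝ) : ℕ → Word → Word → ℝ
  | 0 => fun w w' => if w = w' then 1 else 0
  | n + 1 => fun w w' => ∑' z : Word, Pn β p n w z * P β p z w'

/-- `w'` is accessible from `w`: some `n`-step transition probability is positive. -/
def Accessible (β p : ℝ) (w w' : Word) : Prop :=
  ∃ n : ℕ, 0 < n ∧ 0 < Pn β p n w w'

/-- Two states communicate: each is accessible from the other. -/
def Communicate (β p : ℝ) (w w' : Word) : Prop :=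
  Accessible β p w w' ∧ Accessible β p w' w

instance : MeasurableSpace Word := ⊤

/-- `ξ` is (a realization of) the discrete-time exclusion-voter Markov chain with
parameters `(β, p)` under the probability measure `μ`. -/
def IsEVChain (β p : ℝ) {Ω : Type*} [MeasurableSpace Ω] (μ : Measure Ω)
    (ξ : ℕ → Ω → Word) : Prop :=
  (∀ t, Measurable (ξ t)) ∧
  ∀ (t : ℕ) (path : ℕ → Word),
    μ {ω | ∀ i ≤ t + 1, ξ i ω = path i}
      = μ {ω | ∀ i ≤ t, ξ i ω = path i} * ENNReal.ofReal (P β p (path t) (path (t + 1)))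

/-- The relaxation time `τ = min {t ∈ ℕ, t ≥ 1 : ξ_t = 𝒟₀}` (`∞` if there is no such `t`). -/
noncomputable def relaxTime {Ω : Type*} (ξ : ℕ → Ω → Word) (ω : Ω) : ℝ≥0∞ :=
  sInf {r : ℝ≥0∞ | ∃ t : ℕ, 0 < t ∧ ξ t ω = groundState ∧ r = (t : ℝ≥0∞)}

/-- The size `|S|` of the hybrid zone. -/
def hz (w : Word) : ℕ := w.length

/-- The number of blocks `N(S)`: the number of (finite) `1`-blocks of the hybrid zone. -/
def nb (w : Word) : ℕ :=
  ((Finset.range w.length).filter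
    (fun b => w.getD b false = true ∧ (b = 0 ∨ w.getD (b - 1) true = false))).card

/-- Number of `0`s among the first `c` positions of the hybrid zone. -/
def z0 (w : Word) (c : ℕ) : ℕ :=
  ((Finset.range c).filter (fun a => w.getD a true = false)).card

/-- Number of `1`s of the hybrid zone at positions `≥ c`. -/
def o1 (w : Word) (c : ℕ) : ℕ :=
  ((Finset.Ico c w.length).filter (fun b => w.getD b false = true)).card

/-- `f₁(S) = Σᵢ mᵢ Rᵢ = Σᵢ nᵢ Tᵢ`: each `1` contributes the number of `0`s to its left. -/
def f1 (w : Word) : ℕ :=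
  ∑ b ∈ (Finset.range w.length).filter (fun b => w.getD b false = true), z0 w b

/-- `f₂(S) = (1/2)(Σᵢ mᵢ Rᵢ² + Σᵢ nᵢ Tᵢ²)`: each `1` contributes the squared number of
`0`s to its left, each `0` the squared number of `1`s to its right. -/
noncomputable def f2 (w : Word) : ℝ :=
  (1 / 2) *
    ((∑ b ∈ (Finset.range w.length).filter (fun b => w.getD b false = true),
        ((z0 w b : ℝ)) ^ 2)
     + (∑ a ∈ (Finset.range w.length).filter (fun a => w.getD a true = false),
        ((o1 w (a + 1) : ℝ)) ^ 2))

/-- `g(S) = max_{1 ≤ k ≤ N} R_k T_k`: the maximum over the `01`-corners of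
(number of `0`s up to the corner) × (number of `1`s after the corner). -/
def gfun (w : Word) : ℕ :=
  ((Finset.range w.length).filter
    (fun a => w.getD a true = false ∧ w.getD (a + 1) false = true)).sup
    (fun a => z0 w (a + 1) * o1 w (a + 1))

/-- `φ₁(S) = Σᵢ Σ_{j=R_{i-1}+1}^{R_i} Σ_{k=1}^{T_i} 1/(j+k)`: the `j`-th `0` (at position `a`,
so `j = z0 w (a+1)`) contributes `Σ_{k=1}^{T} 1/(j+k)` with `T` the number of `1`s to its right. -/
noncomputable def phi1 (w : Word) : ℝ :=
  ∑ a ∈ (Finset.range w.length).filter (fun a => w.getD a true = false),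
    ∑ k ∈ Finset.Icc 1 (o1 w (a + 1)), (1 : ℝ) / ((z0 w (a + 1) : ℝ) + (k : ℝ))




/-- The indicator of a `0`. -/
def zeroInd (x : Bool) : ℝ := if x then 0 else 1

/-- The indicator of a `1`. -/
def oneInd (x : Bool) : ℝ := if x then 1 else 0

/-- The ones of a word, weighted by `q` to the power of their position. -/
def onesWeight (q : ℝ) : Word → ℝ
  | [] => 0
  | x :: r => oneInd x + q * onesWeight q r

/-- The zeros of a word, weighted by `q` to the power of their position counted from the end. -/
def zerosWeight (q : ℝ) : Word → ℝ
  | [] => 0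
  | x :: r => zeroInd x * q ^ r.length + zerosWeight q r

/-- The inversions of a word (a `0` at position `a`, a `1` at position `b`, with `a < b`),
each weighted by `q ^ (b - a)`. -/
def invWeight (q : ℝ) : Word → ℝ
  | [] => 0
  | x :: r => zeroInd x * (q * onesWeight q r) + invWeight q r

theorem onesWeight_append (q : ℝ) (l r : Word) :
    onesWeight q (l ++ r) = onesWeight q l + q ^ l.length * onesWeight q r := by
  induction l with
  | nil => simp [onesWeight]
  | cons x l ih => simp only [List.cons_append, onesWeight, ih, List.length_cons]; ring

theorem zerosWeight_append (q : ℝ) (l r : Word) :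
    zerosWeight q (l ++ r) = q ^ r.length * zerosWeight q l + zerosWeight q r := by
  induction l with
  | nil => simp [zerosWeight]
  | cons x l ih => simp only [List.cons_append, zerosWeight, ih, List.length_append]; ring

theorem invWeight_append (q : ℝ) (l r : Word) :
    invWeight q (l ++ r) =
      invWeight q l + invWeight q r + q * zerosWeight q l * onesWeight q r := by
  induction l with
  | nil => simp [zerosWeight, invWeight]
  | cons x l ih =>
    simp only [List.cons_append, invWeight, zerosWeight, ih, onesWeight_append]; ring

theorem zeroInd_nonneg (x : Bool) : 0 ≤ zeroInd x := by cases x <;> simp [zeroInd]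

theorem oneInd_nonneg (x : Bool) : 0 ≤ oneInd x := by cases x <;> simp [oneInd]

theorem zeroInd_eq (x : Bool) : zeroInd x = 1 - oneInd x := by
  cases x <;> simp [zeroInd, oneInd]

theorem onesWeight_nonneg {q : ℝ} (hq : 0 ≤ q) (w : Word) : 0 ≤ onesWeight q w := by
  induction w with
  | nil => simp [onesWeight]
  | cons x r ih => have := oneInd_nonneg x; simp only [onesWeight]; positivity

theorem zerosWeight_nonneg {q : ℝ} (hq : 0 ≤ q) (w : Word) : 0 ≤ zerosWeight q w := by
  induction w with
  | nil => simp [zerosWeight]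
  | cons x r ih => have := zeroInd_nonneg x; simp only [zerosWeight]; positivity

theorem invWeight_nonneg {q : ℝ} (hq : 0 ≤ q) (w : Word) : 0 ≤ invWeight q w := by
  induction w with
  | nil => simp [invWeight]
  | cons x r ih =>
    have := zeroInd_nonneg x
    have := onesWeight_nonneg hq r
    simp only [invWeight]; positivity

theorem onesWeight_mono {q q' : ℝ} (hq : 0 ≤ q) (h : q ≤ q') (w : Word) :
    onesWeight q w ≤ onesWeight q' w := by
  have hq' := hq.trans h
  induction w with
  | nil => simp [onesWeight]
  | cons x r ih =>
    have := onesWeight_nonneg hq r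
    simp only [onesWeight]; gcongr

theorem invWeight_mono {q q' : ℝ} (hq : 0 ≤ q) (h : q ≤ q') (w : Word) :
    invWeight q w ≤ invWeight q' w := by
  have hq' := hq.trans h
  induction w with
  | nil => simp [invWeight]
  | cons x r ih =>
    have := zeroInd_nonneg x
    have := onesWeight_nonneg hq r
    have := onesWeight_mono hq h r
    simp only [invWeight]; gcongr

theorem invWeight_dropWhile_true (q : ℝ) (w : Word) :
    invWeight q (w.dropWhile (· = true)) = invWeight q w := by
  induction w with
  | nil => simp
  | cons x r ih => cases x <;> simp_all [invWeight, zeroInd]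

theorem invWeight_rdropWhile_false (q : ℝ) (w : Word) :
    invWeight q (w.rdropWhile (· = false)) = invWeight q w := by
  induction w using List.reverseRecOn with
  | nil => simp
  | append_singleton l x ih =>
    cases x
    · rw [List.rdropWhile_concat_pos _ _ _ (by simp), ih, invWeight_append]
      simp [invWeight, onesWeight, oneInd]
    · rw [List.rdropWhile_concat_neg _ _ _ (by simp)]

theorem invWeight_strip (q : ℝ) (w : Word) : invWeight q (strip w) = invWeight q w :=
  (invWeight_rdropWhile_false q _).trans (invWeight_dropWhile_true q w)

theorem invWeight_pad (q : ℝ) (w : Word) : invWeight q (pad w) = invWeight q w := by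
  simp [pad, invWeight, zeroInd, invWeight_append, onesWeight, oneInd]

theorem isConfig_strip (w : Word) : IsConfig (strip w) := by
  by_cases h : strip w = []
  · exact Or.inl h
  refine Or.inr ⟨?_, ?_⟩
  · obtain ⟨s, hs⟩ : strip w <+: w.dropWhile (· = true) :=
      List.rdropWhile_prefix (· = false) (w.dropWhile (· = true))
    have hne : w.dropWhile (· = true) ≠ [] := by
      rw [← hs]; simp [h]
    have h1 := List.head_dropWhile_not (· = true) (l := w) hne
    have h2 : (w.dropWhile (· = true)).head? = some false := by
      rw [List.head?_eq_some_head hne]; simpa using h1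
    rwa [← hs, List.head?_append_of_ne_nil _ h] at h2
  · have h1 := List.rdropWhile_last_not (p := (· = false)) (w.dropWhile (· = true)) h
    have h2 : (strip w).getLast h = true := by simpa [strip, List.rdropWhile] using h1
    rw [List.getLast?_eq_some_getLast h, h2]

theorem pow_length_le_invWeight {q : ℝ} (hq : 0 ≤ q) {w : Word} (hw : IsConfig w)
    (hne : w ≠ []) : q ^ w.length ≤ q * invWeight q w := by
  obtain rfl | ⟨h1, h2⟩ := hw
  · exact absurd rfl hne
  obtain ⟨l, rfl⟩ : ∃ l, w = l ++ [true] := List.getLast?_eq_some_iff.1 h2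
  cases l with
  | nil => simp at h1
  | cons x l =>
    obtain rfl : x = false := by simpa using h1
    have h3 := zerosWeight_nonneg hq l
    have h4 := invWeight_nonneg hq (false :: l)
    rw [invWeight_append]
    simp only [invWeight, zerosWeight, onesWeight, oneInd, zeroInd, List.length_append,
      List.length_cons, List.length_nil] at *
    simp at *
    have : q ^ (l.length + 1 + 1) = q * (q * q ^ l.length) := by ring
    rw [this]
    have h5 : 0 ≤ q * zerosWeight q l := by positivity
    gcongr
    linarith

theorem sum_map_filter_range (n : ℕ) (r : ℕ → Bool) (f : ℕ → ℝ) :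
    (((List.range n).filter r).map f).sum = ∑ i ∈ Finset.range n, if r i then f i else 0 := by
  induction n with
  | zero => simp
  | succ n ih =>
    rw [List.range_succ, List.filter_append, List.map_append, List.sum_append, ih,
      Finset.sum_range_succ]
    cases h : r n <;> simp [h]

theorem setPair_eq {v : Word} {i : ℕ} (hi : i + 1 < v.length) (a b : Bool) :
    setPair v i a b = v.take i ++ a :: b :: v.drop (i + 2) := by
  apply List.ext_getElem?
  intro j
  simp only [setPair, List.getElem?_set, List.getElem?_append, List.getElem?_take,
    List.length_take, List.length_set]
  grind

theorem invWeight_setPair (q : ℝ) {v : Word} {i : ℕ} (hi : i + 1 < v.length) (a b : Bool) :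
    invWeight q (setPair v i a b) =
      invWeight q (v.take i) + invWeight q (v.drop (i + 2))
      + q ^ 3 * zerosWeight q (v.take i) * onesWeight q (v.drop (i + 2))
      + zeroInd a * oneInd b * q
      + q * zerosWeight q (v.take i) * (oneInd a + q * oneInd b)
      + q * onesWeight q (v.drop (i + 2)) * (q * zeroInd a + zeroInd b) := by
  rw [setPair_eq hi, invWeight_append]
  simp only [invWeight, onesWeight]; ring

theorem setPair_self {v : Word} {i : ℕ} (hi : i + 1 < v.length) :
    setPair v i (v.getD i true) (v.getD (i + 1) true) = v := by
  apply List.ext_getElem?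
  intro j
  simp only [setPair, List.getElem?_set, List.length_set]
  grind


theorem take_succ_getD {v : Word} {i : ℕ} (hi : i < v.length) :
    v.take (i + 1) = v.take i ++ [v.getD i true] := by
  rw [List.take_add_one, List.getElem?_eq_getElem hi, List.getD_eq_getElem _ _ hi]
  rfl

theorem drop_eq_getD_cons {v : Word} {i : ℕ} (hi : i < v.length) :
    v.drop i = v.getD i true :: v.drop (i + 1) := by
  rw [List.drop_eq_getElem_cons hi, List.getD_eq_getElem _ _ hi]

/-- The number of adjacent pairs `01` among the first `k` adjacent pairs of `v`. -/
def risingPairs (v : Word) (k : ℕ) : ℝ :=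
  ∑ i ∈ Finset.range k, zeroInd (v.getD i true) * oneInd (v.getD (i + 1) true)

theorem risingPairs_nonneg (v : Word) (k : ℕ) : 0 ≤ risingPairs v k :=
  Finset.sum_nonneg fun _ _ => mul_nonneg (zeroInd_nonneg _) (oneInd_nonneg _)

theorem sum_sub_mul_zerosWeight {q : ℝ} (hq : q ≠ 0) (v : Word) (k : ℕ) (hk : k + 1 ≤ v.length) :
    ∑ i ∈ Finset.range k, (oneInd (v.getD i true) - oneInd (v.getD (i + 1) true)) *
        (q * zerosWeight q (v.take i)) =
      (1 - q⁻¹) * invWeight q (v.take (k + 1)) + risingPairs v k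
        - oneInd (v.getD k true) * (q * zerosWeight q (v.take k)) := by
  induction k with
  | zero =>
    rw [take_succ_getD (by omega)]
    simp [risingPairs, invWeight, zerosWeight, onesWeight]
  | succ k ih =>
    rw [Finset.sum_range_succ, ih (by omega), risingPairs, risingPairs, Finset.sum_range_succ,
      take_succ_getD (i := k + 1) (by omega), invWeight_append q (v.take (k + 1)),
      take_succ_getD (i := k) (by omega), zerosWeight_append]
    simp only [invWeight, onesWeight, zerosWeight, List.length_cons, List.length_nil]
    field_simp
    ring

theorem sum_sub_mul_onesWeight {q : ℝ} (hq : q ≠ 0) (v : Word) (k : ℕ) (hk : k + 1 ≤ v.length) :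
    ∑ i ∈ Finset.range k, (oneInd (v.getD i true) - oneInd (v.getD (i + 1) true)) *
        (q * onesWeight q (v.drop (i + 2))) =
      risingPairs v k + (invWeight q (v.drop 1) - invWeight q (v.drop (k + 1)))
        - q⁻¹ * (invWeight q v - invWeight q (v.drop k)) := by
  induction k with
  | zero => simp [risingPairs]
  | succ k ih =>
    rw [Finset.sum_range_succ, ih (by omega), risingPairs, risingPairs, Finset.sum_range_succ,
      drop_eq_getD_cons (v := v) (i := k) (by omega),
      drop_eq_getD_cons (v := v) (i := k + 1) (by omega)]
    simp only [invWeight, onesWeight, zeroInd_eq]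
    field_simp
    ring

theorem getD_pad_zero (w : Word) : (pad w).getD 0 true = true := rfl

theorem getD_pad_last (w : Word) : (pad w).getD (w.length + 1) true = false := by
  simp [pad]

theorem length_pad (w : Word) : (pad w).length = w.length + 2 := by simp [pad]

theorem drop_pad_last (w : Word) : (pad w).drop (w.length + 1) = [false] := by
  simp [pad]

theorem sum_sub_pad (w : Word) :
    ∑ i ∈ Finset.range (w.length + 1),
      (oneInd ((pad w).getD i true) - oneInd ((pad w).getD (i + 1) true)) = 1 := by
  rw [Finset.sum_range_sub', getD_pad_zero, getD_pad_last]
  simp [oneInd]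

theorem sum_sub_mul_weights_pad {q : ℝ} (hq : q ≠ 0) (w : Word) :
    ∑ i ∈ Finset.range (w.length + 1),
      (oneInd ((pad w).getD i true) - oneInd ((pad w).getD (i + 1) true)) *
        (q * zerosWeight q ((pad w).take i) + q * onesWeight q ((pad w).drop (i + 2))) =
      2 * ((1 - q⁻¹) * invWeight q w + risingPairs (pad w) (w.length + 1)) := by
  have hl := length_pad w
  simp only [mul_add, Finset.sum_add_distrib]
  simp only [← mul_add]
  rw [sum_sub_mul_zerosWeight hq _ _ (by omega), sum_sub_mul_onesWeight hq _ _ (by omega),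
    List.take_of_length_le (by omega), List.drop_of_length_le (i := w.length + 1 + 1) (by omega),
    drop_pad_last, getD_pad_last, invWeight_pad]
  have h : invWeight q ((pad w).drop 1) = invWeight q w := by
    simp [pad, invWeight_append, invWeight, onesWeight, oneInd]
  rw [h]
  simp [invWeight, oneInd, onesWeight]
  ring

theorem length_unlike (w : Word) :
    ((unlike w).length : ℝ) = 2 * risingPairs (pad w) (w.length + 1) + 1 := by
  have h1 : ((unlike w).length : ℝ) = ((unlike w).map fun _ => (1 : ℝ)).sum := by simp
  refine Eq.trans ?_ (congrArg (_ + ·) (sum_sub_pad w))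
  rw [h1, unlike, sum_map_filter_range, risingPairs, Finset.mul_sum, ← Finset.sum_add_distrib]
  refine Finset.sum_congr rfl fun i _ => ?_
  cases (pad w).getD i true <;> cases (pad w).getD (i + 1) true <;>
    norm_num [oneInd, zeroInd]

/-- The mean of `invWeight` after a move at the unlike pair `i` of `v`. -/
theorem pair_drift_le {β p q : ℝ} (hβ0 : 0 ≤ β) (hβ1 : β ≤ 1) (hp : 1 / 2 ≤ p) (hq : 1 ≤ q)
    {v : Word} {i : ℕ} (hi : i + 1 < v.length) (hne : v.getD i true ≠ v.getD (i + 1) true) :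
    β * (1 / 2) * invWeight q (setPair v i false false)
      + β * (1 / 2) * invWeight q (setPair v i true true)
      + (1 - β) * (if v.getD i true then 1 - p else p) * invWeight q (swapPair v i)
      + (1 - β) * (1 - if v.getD i true then 1 - p else p) * invWeight q v ≤
    invWeight q v + (1 / 2) * (q - 1) *
        ((oneInd (v.getD i true) - oneInd (v.getD (i + 1) true)) *
          (q * zerosWeight q (v.take i) + q * onesWeight q (v.drop (i + 2))))
      + (1 - β) * (q / 2) * (oneInd (v.getD i true) - oneInd (v.getD (i + 1) true)) := by
  have hA := zerosWeight_nonneg (zero_le_one.trans hq) (v.take i)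
  have hB := onesWeight_nonneg (zero_le_one.trans hq) (v.drop (i + 2))
  have hself := invWeight_setPair q hi (v.getD i true) (v.getD (i + 1) true)
  rw [setPair_self hi] at hself
  rw [swapPair, hself]
  simp only [invWeight_setPair q hi]
  set A := zerosWeight q (v.take i)
  set B := onesWeight q (v.drop (i + 2))
  have hpq : 0 ≤ (1 - β) * (p - 1 / 2) * ((q - 1) * (q * A + q * B) + q) := by
    have := sub_nonneg.2 hq
    have := sub_nonneg.2 hβ1
    have := sub_nonneg.2 hp
    positivity
  have hβq : 0 ≤ β * q := by positivity
  cases h1 : v.getD i true <;> cases h2 : v.getD (i + 1) true <;> rw [h1, h2] at hne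
  · exact absurd rfl hne
  · simp [oneInd, zeroInd]
    nlinarith
  · simp [oneInd, zeroInd]
    nlinarith
  · exact absurd rfl hne

/-- The mean of `F` after one step of the chain from `w`. -/
noncomputable def stepMean (β p : ℝ) (w : Word) (F : Word → ℝ) : ℝ :=
  ((unlike w).map (fun i =>
    let a := (pad w).getD i true
    let swapProb := if a then 1 - p else p
    ((unlike w).length : ℝ)⁻¹ *
      (β * (1 / 2) * F (strip (setPair (pad w) i false false))
       + β * (1 / 2) * F (strip (setPair (pad w) i true true))
       + (1 - β) * swapProb * F (strip (swapPair (pad w) i))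
       + (1 - β) * (1 - swapProb) * F w))).sum

theorem stepMean_invWeight_le {β p q : ℝ} (hβ0 : 0 ≤ β) (hβ1 : β ≤ 1) (hp : 1 / 2 ≤ p)
    (hq : 1 ≤ q) (w : Word) :
    stepMean β p w (invWeight q) ≤ (1 + (q - 1) ^ 2) * invWeight q w + q := by
  have hN := risingPairs_nonneg (pad w) (w.length + 1)
  have hL := length_unlike w
  have hΦ := invWeight_nonneg (zero_le_one.trans hq) w
  set L : ℝ := ((unlike w).length : ℝ) with hLdef
  set N := risingPairs (pad w) (w.length + 1) with hNdef
  have hL1 : 1 ≤ L := by linarith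
  have hsum : stepMean β p w (invWeight q) ≤ L⁻¹ * (L * invWeight q w
      + (1 / 2) * (q - 1) * (2 * ((1 - q⁻¹) * invWeight q w + N))
      + (1 - β) * (q / 2) * ∑ i ∈ Finset.range (w.length + 1),
        (oneInd ((pad w).getD i true) - oneInd ((pad w).getD (i + 1) true))) := by
    rw [hNdef, ← sum_sub_mul_weights_pad (by linarith) w]
    have h1 : L * invWeight q w = ((unlike w).map fun _ => invWeight q w).sum := by
      simp [hLdef]
    rw [h1, stepMean, unlike, sum_map_filter_range, sum_map_filter_range, Finset.mul_sum,
      Finset.mul_sum, ← Finset.sum_add_distrib, ← Finset.sum_add_distrib, Finset.mul_sum]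
    refine Finset.sum_le_sum fun i hi => ?_
    by_cases hne : (pad w).getD i true = (pad w).getD (i + 1) true
    · simp [hne, -List.getD_eq_getElem?_getD]
    · have hl : i + 1 < (pad w).length := by
        rw [length_pad]; have := Finset.mem_range.1 hi; omega
      simp only [hne, ne_eq, not_false_eq_true, decide_true, if_true, invWeight_strip]
      refine mul_le_mul_of_nonneg_left ?_ (by positivity)
      have := pair_drift_le hβ0 hβ1 hp hq hl hne
      rwa [invWeight_pad] at this
  rw [sum_sub_pad] at hsum
  refine hsum.trans ?_
  rw [inv_mul_le_iff₀ (by positivity)]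
  have hqi : 1 - q⁻¹ ≤ q - 1 := by
    have hq0 : 0 < q := by linarith
    have : 2 ≤ q + q⁻¹ := by
      have h : q + q⁻¹ - 2 = (q - 1) ^ 2 * q⁻¹ := by field_simp; ring
      have : 0 ≤ (q - 1) ^ 2 * q⁻¹ := by positivity
      linarith
    linarith
  have h2 : (q - 1) * (1 - q⁻¹) * invWeight q w ≤ (q - 1) ^ 2 * invWeight q w := by
    rw [pow_two]
    have := sub_nonneg.2 hq
    gcongr
  have h3 : 0 ≤ (L - 1) * ((q - 1) ^ 2 * invWeight q w) :=
    mul_nonneg (by linarith) (by positivity)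
  nlinarith [mul_nonneg hβ0 (zero_le_one.trans hq), mul_nonneg hN (zero_le_one.trans hq)]

theorem stepMean_nonneg {β p : ℝ} (hβ0 : 0 ≤ β) (hβ1 : β ≤ 1) (hp0 : 0 ≤ p) (hp1 : p ≤ 1)
    (w : Word) {F : Word → ℝ} (hF : ∀ w, 0 ≤ F w) : 0 ≤ stepMean β p w F := by
  refine List.sum_nonneg fun x hx => ?_
  obtain ⟨i, -, rfl⟩ := List.mem_map.1 hx
  have h1 : 0 ≤ 1 - β := sub_nonneg.2 hβ1
  have h2 : 0 ≤ 1 - p := sub_nonneg.2 hp1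
  have h3 := hF (strip (setPair (pad w) i false false))
  have h4 := hF (strip (setPair (pad w) i true true))
  have h5 := hF (strip (swapPair (pad w) i))
  have h6 := hF w
  cases (pad w).getD i true
  · simp only [Bool.false_eq_true, if_false]; positivity
  · simp only [if_true, sub_sub_cancel]; positivity

theorem stepMean_eq_zero (β p : ℝ) {w : Word} {F : Word → ℝ} (hF : ∀ v, F (strip v) = 0)
    (hw : F w = 0) : stepMean β p w F = 0 := by
  simp [stepMean, hF, hw]

theorem hasSum_list_sum {ι α : Type*} (l : List ι) (f : ι → α → ℝ) (g : ι → ℝ)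
    (h : ∀ i, HasSum (f i) (g i)) : HasSum (fun a => (l.map fun i => f i a).sum) (l.map g).sum := by
  induction l with
  | nil => simp
  | cons i l ih => simpa using (h i).add ih

theorem hasSum_P_mul (β p : ℝ) (w : Word) (F : Word → ℝ) :
    HasSum (fun w' => P β p w w' * F w') (stepMean β p w F) := by
  have single (s : Word) : HasSum (fun w' => (if s = w' then (1 : ℝ) else 0) * F w') (F s) := by
    have h := hasSum_single (f := fun w' => (if s = w' then (1 : ℝ) else 0) * F w') s
      (fun w' hw' => by simp [hw'.symm])
    simpa using h
  simp only [P, ← List.sum_map_mul_right]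
  refine hasSum_list_sum _ _ _ fun i => ?_
  have h := ((((((single (strip (setPair (pad w) i false false))).mul_left (β * (1 / 2))).add
    ((single (strip (setPair (pad w) i true true))).mul_left (β * (1 / 2)))).add
    ((single (strip (swapPair (pad w) i))).mul_left
      ((1 - β) * if (pad w).getD i true then 1 - p else p))).add
    ((single w).mul_left ((1 - β) * (1 - if (pad w).getD i true then 1 - p else p)))).mul_left
      (((unlike w).length : ℝ)⁻¹))
  refine Eq.mp (congrArg (HasSum · _) (funext fun w' => ?_)) h
  ring

theorem P_nonneg {β p : ℝ} (hβ0 : 0 ≤ β) (hβ1 : β ≤ 1) (hp0 : 0 ≤ p) (hp1 : p ≤ 1)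
    (w w' : Word) : 0 ≤ P β p w w' :=
  stepMean_nonneg hβ0 hβ1 hp0 hp1 w (F := fun x => if x = w' then 1 else 0)
    fun x => by split_ifs <;> simp

theorem tsum_ofReal_P_mul {β p : ℝ} (hβ0 : 0 ≤ β) (hβ1 : β ≤ 1) (hp0 : 0 ≤ p) (hp1 : p ≤ 1)
    (w : Word) {F : Word → ℝ} (hF : ∀ w, 0 ≤ F w) :
    ∑' w', ENNReal.ofReal (P β p w w') * ENNReal.ofReal (F w') =
      ENNReal.ofReal (stepMean β p w F) := by
  have h := hasSum_P_mul β p w F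
  have h0 := P_nonneg hβ0 hβ1 hp0 hp1 w
  rw [← h.tsum_eq, ENNReal.ofReal_tsum_of_nonneg (fun w' => mul_nonneg (h0 w') (hF w')) h.summable]
  simp only [ENNReal.ofReal_mul (h0 _)]

section Chain

variable {β p : ℝ} {Ω : Type*} [MeasurableSpace Ω] {μ : Measure Ω} {ξ : ℕ → Ω → Word}

theorem IsEVChain.measure_pair (hξ : IsEVChain β p μ ξ) (t : ℕ) (w w' : Word) :
    μ {ω | ξ t ω = w ∧ ξ (t + 1) ω = w'} =
      μ {ω | ξ t ω = w} * ENNReal.ofReal (P β p w w') := by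
  let path (g : Fin t → Word) (i : ℕ) : Word :=
    if h : i < t then g ⟨i, h⟩ else if i = t then w else w'
  have hm (s : ℕ) (x : Word) : MeasurableSet {ω | ξ s ω = x} := hξ.1 s (measurableSet_singleton x)
  have hpm (s : ℕ) (f : ℕ → Word) : MeasurableSet {ω | ∀ i ≤ s, ξ i ω = f i} := by
    have : {ω | ∀ i ≤ s, ξ i ω = f i} = ⋂ i ∈ Set.Iic s, {ω | ξ i ω = f i} := by
      ext; simp
    rw [this]
    exact MeasurableSet.biInter (Set.to_countable _) fun i _ => hm i _
  have hpath (g : Fin t → Word) (i : Fin t) : path g i = g i := by simp [path]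
  have hdisj (s : ℕ) (hs : t ≤ s) :
      Pairwise (Function.onFun Disjoint fun g => {ω | ∀ i ≤ s, ξ i ω = path g i}) := by
    intro g g' hne
    refine Set.disjoint_left.2 fun ω h h' => hne (funext fun i => ?_)
    rw [← hpath g, ← hpath g', ← h i (by omega), ← h' i (by omega)]
  have h1 : {ω | ξ t ω = w} = ⋃ g : Fin t → Word, {ω | ∀ i ≤ t, ξ i ω = path g i} := by
    ext ω
    simp only [Set.mem_ofPred_eq, Set.mem_iUnion]
    constructor
    · intro h
      refine ⟨fun i => ξ i ω, fun i hi => ?_⟩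
      rcases hi.lt_or_eq with hi | rfl
      · simp [path, hi]
      · simp [path, h]
    · rintro ⟨g, hg⟩
      simpa [path] using hg t le_rfl
  have h2 : {ω | ξ t ω = w ∧ ξ (t + 1) ω = w'} =
      ⋃ g : Fin t → Word, {ω | ∀ i ≤ t + 1, ξ i ω = path g i} := by
    ext ω
    simp only [Set.mem_ofPred_eq, Set.mem_iUnion]
    constructor
    · rintro ⟨h, h'⟩
      refine ⟨fun i => ξ i ω, fun i hi => ?_⟩
      rcases hi.lt_or_eq with hi | rfl
      · rcases (Nat.lt_succ_iff.1 hi).lt_or_eq with hi | rfl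
        · simp [path, hi]
        · simp [path, h]
      · simp [path, h']
    · rintro ⟨g, hg⟩
      exact ⟨by simpa [path] using hg t (by omega), by simpa [path] using hg (t + 1) le_rfl⟩
  rw [h2, h1, measure_iUnion (hdisj _ (by omega)) fun g => hpm _ _,
    measure_iUnion (hdisj _ le_rfl) fun g => hpm _ _, ← ENNReal.tsum_mul_right]
  refine tsum_congr fun g => ?_
  rw [hξ.2 t (path g)]
  simp [path]

theorem IsEVChain.lintegral_succ (hξ : IsEVChain β p μ ξ) (t : ℕ) (F : Word → ℝ≥0∞) :
    ∫⁻ ω, F (ξ (t + 1) ω) ∂μ =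
      ∫⁻ ω, ∑' w', ENNReal.ofReal (P β p (ξ t ω) w') * F w' ∂μ := by
  have hpair : Measurable fun ω => (ξ t ω, ξ (t + 1) ω) := (hξ.1 t).prodMk (hξ.1 (t + 1))
  have h1 : ∫⁻ ω, F (ξ (t + 1) ω) ∂μ =
      ∫⁻ x : Word × Word, F x.2 ∂(μ.map fun ω => (ξ t ω, ξ (t + 1) ω)) :=
    (lintegral_map (f := fun x : Word × Word => F x.2) (measurable_of_countable _) hpair).symm
  have h2 : ∫⁻ ω, ∑' w', ENNReal.ofReal (P β p (ξ t ω) w') * F w' ∂μ =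
      ∫⁻ x : Word, ∑' w', ENNReal.ofReal (P β p x w') * F w' ∂(μ.map (ξ t)) :=
    (lintegral_map (f := fun x : Word => ∑' w', ENNReal.ofReal (P β p x w') * F w')
      (measurable_of_countable _) (hξ.1 t)).symm
  rw [h1, h2, lintegral_countable', lintegral_countable', ENNReal.tsum_prod']
  refine tsum_congr fun w => ?_
  rw [← ENNReal.tsum_mul_right]
  refine tsum_congr fun w' => ?_
  rw [Measure.map_apply hpair (measurableSet_singleton _),
    Measure.map_apply (hξ.1 t) (measurableSet_singleton _)]
  have h3 := hξ.measure_pair t w w'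
  have h4 : (fun ω => (ξ t ω, ξ (t + 1) ω)) ⁻¹' {(w, w')} =
      {ω | ξ t ω = w ∧ ξ (t + 1) ω = w'} := by ext; simp
  have h5 : ξ t ⁻¹' {w} = {ω | ξ t ω = w} := rfl
  rw [h4, h5, h3]
  ring

theorem IsEVChain.lintegral_ofReal_succ (hξ : IsEVChain β p μ ξ) (hβ0 : 0 ≤ β) (hβ1 : β ≤ 1)
    (hp0 : 0 ≤ p) (hp1 : p ≤ 1) (t : ℕ) {F : Word → ℝ} (hF : ∀ w, 0 ≤ F w) :
    ∫⁻ ω, ENNReal.ofReal (F (ξ (t + 1) ω)) ∂μ =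
      ∫⁻ ω, ENNReal.ofReal (stepMean β p (ξ t ω) F) ∂μ := by
  rw [hξ.lintegral_succ t fun w => ENNReal.ofReal (F w)]
  simp only [tsum_ofReal_P_mul hβ0 hβ1 hp0 hp1 _ hF]

open Classical in
theorem IsEVChain.ae_isConfig (hξ : IsEVChain β p μ ξ) (hβ0 : 0 ≤ β) (hβ1 : β ≤ 1)
    (hp0 : 0 ≤ p) (hp1 : p ≤ 1) (h0 : ∀ᵐ ω ∂μ, IsConfig (ξ 0 ω)) (t : ℕ) :
    ∀ᵐ ω ∂μ, IsConfig (ξ t ω) := by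
  induction t with
  | zero => exact h0
  | succ t ih =>
    let F : Word → ℝ := fun w => if IsConfig w then 0 else 1
    have hF (w : Word) : 0 ≤ F w := by simp only [F]; split_ifs <;> simp
    have h1 : ∫⁻ ω, ENNReal.ofReal (F (ξ (t + 1) ω)) ∂μ = 0 := by
      rw [hξ.lintegral_ofReal_succ hβ0 hβ1 hp0 hp1 t hF]
      refine (lintegral_congr_ae ?_).trans lintegral_zero
      filter_upwards [ih] with ω hω
      rw [stepMean_eq_zero β p (fun v => if_pos (isConfig_strip v)) (if_pos hω)]
      simp
    have hmeas : Measurable fun ω => ENNReal.ofReal (F (ξ (t + 1) ω)) :=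
      (measurable_of_countable fun w => ENNReal.ofReal (F w)).comp (hξ.1 (t + 1))
    rw [lintegral_eq_zero_iff hmeas] at h1
    filter_upwards [h1] with ω hω
    by_contra hc
    simp [F, hc] at hω

theorem IsEVChain.lintegral_invWeight_le [IsProbabilityMeasure μ] (hξ : IsEVChain β p μ ξ)
    (hβ0 : 0 ≤ β) (hβ1 : β ≤ 1) (hp : 1 / 2 ≤ p) (hp1 : p ≤ 1) {S₀ : Word}
    (h0 : ∀ᵐ ω ∂μ, ξ 0 ω = S₀) {q : ℝ} (hq : 1 ≤ q) (t : ℕ) :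
    ∫⁻ ω, ENNReal.ofReal (invWeight q (ξ t ω)) ∂μ ≤
      ENNReal.ofReal ((1 + (q - 1) ^ 2) ^ t * (invWeight q S₀ + q * t)) := by
  have hq0 : 0 ≤ q := zero_le_one.trans hq
  have hΦ := invWeight_nonneg hq0 S₀
  induction t with
  | zero =>
    have h1 : ∫⁻ ω, ENNReal.ofReal (invWeight q (ξ 0 ω)) ∂μ =
        ∫⁻ _, ENNReal.ofReal (invWeight q S₀) ∂μ := by
      refine lintegral_congr_ae ?_
      filter_upwards [h0] with ω hω
      rw [hω]
    rw [h1]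
    simp
  | succ t ih =>
    rw [hξ.lintegral_ofReal_succ hβ0 hβ1 (by linarith) hp1 t (invWeight_nonneg hq0)]
    set c : ℝ := 1 + (q - 1) ^ 2
    have hc : 1 ≤ c := le_add_of_nonneg_right (sq_nonneg _)
    have hc0 : 0 ≤ c := zero_le_one.trans hc
    calc ∫⁻ ω, ENNReal.ofReal (stepMean β p (ξ t ω) (invWeight q)) ∂μ
        ≤ ∫⁻ ω, (ENNReal.ofReal c * ENNReal.ofReal (invWeight q (ξ t ω))
            + ENNReal.ofReal q) ∂μ := by
          refine lintegral_mono fun ω => ?_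
          rw [← ENNReal.ofReal_mul hc0,
            ← ENNReal.ofReal_add (mul_nonneg hc0 (invWeight_nonneg hq0 _)) hq0]
          exact ENNReal.ofReal_le_ofReal (stepMean_invWeight_le hβ0 hβ1 hp hq _)
      _ = ENNReal.ofReal c * ∫⁻ ω, ENNReal.ofReal (invWeight q (ξ t ω)) ∂μ
            + ENNReal.ofReal q := by
          rw [lintegral_add_right _ measurable_const, lintegral_const_mul' _ _ ENNReal.ofReal_ne_top]
          simp
      _ ≤ ENNReal.ofReal c * ENNReal.ofReal (c ^ t * (invWeight q S₀ + q * t))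
            + ENNReal.ofReal q := by gcongr
      _ ≤ ENNReal.ofReal (c ^ (t + 1) * (invWeight q S₀ + q * (t + 1 : ℕ))) := by
          rw [← ENNReal.ofReal_mul hc0, ← ENNReal.ofReal_add (by positivity) hq0]
          refine ENNReal.ofReal_le_ofReal ?_
          have h1 : 1 * q ≤ c ^ (t + 1) * q := by
            gcongr
            exact one_le_pow₀ hc
          push_cast
          have h2 : c * (c ^ t * (invWeight q S₀ + q * t)) =
            c ^ (t + 1) * (invWeight q S₀ + q * t) := by ring
          rw [h2]
          linarith

end Chain

theorem IsEVChain.measure_length_gt_le {β p : ℝ} {Ω : Type*} [MeasurableSpace Ω] {μ : Measure Ω}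
    [IsProbabilityMeasure μ] {ξ : ℕ → Ω → Word} (hξ : IsEVChain β p μ ξ)
    (hβ0 : 0 ≤ β) (hβ1 : β ≤ 1) (hp : 1 / 2 ≤ p) (hp1 : p ≤ 1) {S₀ : Word} (hS₀ : IsConfig S₀)
    (h0 : ∀ᵐ ω ∂μ, ξ 0 ω = S₀) {t : ℕ} (ht : 1 ≤ t) :
    μ {ω | 8 * √(t * Real.log t) < (hz (ξ t ω) : ℝ)} ≤
      ENNReal.ofReal (3 * (invWeight 3 S₀ + 3) * (1 / (t : ℝ) ^ 3)) := by
  have ht1 : (1 : ℝ) ≤ t := by exact_mod_cast ht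
  have ht0 : (0 : ℝ) < t := by linarith
  have hlog : 0 ≤ Real.log t := Real.log_nonneg ht1
  set r : ℝ := √(Real.log t / t) with hr
  have hr0 : 0 ≤ r := Real.sqrt_nonneg _
  have hr2 : r ^ 2 = Real.log t / t := Real.sq_sqrt (by positivity)
  have hr1 : r ≤ 1 := by
    refine Real.sqrt_le_one.2 ?_
    rw [div_le_one ht0]
    linarith [Real.log_le_sub_one_of_pos ht0]
  set q : ℝ := Real.exp r
  have hq1 : 1 ≤ q := Real.one_le_exp hr0
  have hq0 : 0 ≤ q := zero_le_one.trans hq1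
  have hq3 : q ≤ 3 := (Real.exp_le_exp.2 hr1).trans Real.exp_one_lt_three.le
  have hqr : q - 1 ≤ 2 * r := by
    have := Real.abs_exp_sub_one_le (x := r) (by rwa [abs_of_nonneg hr0])
    rw [abs_of_nonneg hr0] at this
    exact (le_abs_self _).trans this
  have hgrow : (1 + (q - 1) ^ 2) ^ t ≤ (t : ℝ) ^ 4 := by
    have h1 : 1 + (q - 1) ^ 2 ≤ Real.exp (4 * r ^ 2) := by
      have h2 : (q - 1) ^ 2 ≤ (2 * r) ^ 2 := pow_le_pow_left₀ (by linarith) hqr 2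
      linarith [Real.add_one_le_exp (4 * r ^ 2)]
    calc (1 + (q - 1) ^ 2) ^ t ≤ Real.exp (4 * r ^ 2) ^ t := by gcongr
      _ = Real.exp (4 * Real.log t) := by
        rw [← Real.exp_nat_mul, hr2]; congr 1; field_simp
      _ = (t : ℝ) ^ 4 := by
        rw [mul_comm, Real.exp_mul, Real.exp_log ht0]; norm_cast
  have hΦ3 : invWeight q S₀ ≤ invWeight 3 S₀ := invWeight_mono hq0 hq3 S₀
  have hΦ0 := invWeight_nonneg hq0 S₀
  have hmean : ∫⁻ ω, ENNReal.ofReal (invWeight q (ξ t ω)) ∂μ ≤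
      ENNReal.ofReal ((t : ℝ) ^ 5 * (invWeight 3 S₀ + 3)) := by
    refine (hξ.lintegral_invWeight_le hβ0 hβ1 hp hp1 h0 hq1 t).trans
      (ENNReal.ofReal_le_ofReal ?_)
    calc (1 + (q - 1) ^ 2) ^ t * (invWeight q S₀ + q * t)
        ≤ (t : ℝ) ^ 4 * (invWeight 3 S₀ * t + 3 * t) := by
          gcongr
          nlinarith
      _ = _ := by ring
  have hcfg : ∀ᵐ ω ∂μ, IsConfig (ξ t ω) :=
    hξ.ae_isConfig hβ0 hβ1 (by linarith) hp1 (h0.mono fun ω h => h ▸ hS₀) t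
  have hsub : μ {ω | 8 * √(t * Real.log t) < (hz (ξ t ω) : ℝ)} ≤
      μ {ω | ENNReal.ofReal ((t : ℝ) ^ 8 / 3) ≤ ENNReal.ofReal (invWeight q (ξ t ω))} := by
    refine measure_mono_ae ?_
    filter_upwards [hcfg] with ω hω hlt
    refine ENNReal.ofReal_le_ofReal ?_
    have hlt : 8 * √(t * Real.log t) < ((ξ t ω).length : ℝ) := hlt
    have hne : ξ t ω ≠ [] := by
      intro h
      rw [h] at hlt
      have := Real.sqrt_nonneg (t * Real.log t)
      rw [List.length_nil, Nat.cast_zero] at hlt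
      linarith
    have h1 := pow_length_le_invWeight hq0 hω hne
    have h2 : (t : ℝ) ^ 8 ≤ q ^ (ξ t ω).length := by
      have h3 : r * √(t * Real.log t) = Real.log t := by
        rw [hr, ← Real.sqrt_mul (by positivity)]
        rw [show Real.log t / t * (t * Real.log t) = Real.log t * Real.log t by field_simp]
        exact Real.sqrt_mul_self hlog
      calc (t : ℝ) ^ 8 = Real.exp (8 * Real.log t) := by
            rw [mul_comm, Real.exp_mul, Real.exp_log ht0]; norm_cast
        _ = Real.exp (8 * √(t * Real.log t) * r) := by
            rw [mul_assoc, mul_comm √(t * Real.log t), h3]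
        _ ≤ Real.exp ((ξ t ω).length * r) := by gcongr
        _ = q ^ (ξ t ω).length := by rw [Real.exp_nat_mul]
    have h4 := mul_le_mul_of_nonneg_right hq3 (invWeight_nonneg hq0 (ξ t ω))
    linarith
  have hpos : (0 : ℝ) < (t : ℝ) ^ 8 / 3 := by positivity
  have hmeas : Measurable fun ω => ENNReal.ofReal (invWeight q (ξ t ω)) :=
    (measurable_of_countable fun w => ENNReal.ofReal (invWeight q w)).comp (hξ.1 t)
  refine hsub.trans ((meas_ge_le_lintegral_div hmeas.aemeasurable
    (by simpa using hpos) ENNReal.ofReal_ne_top).trans ?_)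
  refine (ENNReal.div_le_div_right hmean _).trans ?_
  rw [← ENNReal.ofReal_div_of_pos hpos]
  refine ENNReal.ofReal_le_ofReal (le_of_eq ?_)
  field_simp

theorem IsEVChain.ae_eventually_length_le {β p : ℝ} {Ω : Type*} [MeasurableSpace Ω]
    {μ : Measure Ω} [IsProbabilityMeasure μ] {ξ : ℕ → Ω → Word} (hξ : IsEVChain β p μ ξ)
    (hβ0 : 0 ≤ β) (hβ1 : β ≤ 1) (hp : 1 / 2 ≤ p) (hp1 : p ≤ 1) {S₀ : Word} (hS₀ : IsConfig S₀)
    (h0 : ∀ᵐ ω ∂μ, ξ 0 ω = S₀) :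
    ∀ᵐ ω ∂μ, ∀ᶠ t : ℕ in atTop, (hz (ξ t ω) : ℝ) ≤ 8 * √(t * Real.log t) := by
  have hsum : Summable fun t : ℕ => 3 * (invWeight 3 S₀ + 3) * (1 / ((t + 1 : ℕ) : ℝ) ^ 3) :=
    ((summable_nat_add_iff 1).2 (Real.summable_one_div_nat_pow.2 (by norm_num))).mul_left _
  have hfin : ∑' t : ℕ, μ {ω | 8 * √((t + 1 : ℕ) * Real.log (t + 1 : ℕ)) <
      (hz (ξ (t + 1) ω) : ℝ)} ≠ ∞ := by
    refine ne_top_of_le_ne_top hsum.tsum_ofReal_ne_top (ENNReal.tsum_le_tsum fun t => ?_)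
    exact hξ.measure_length_gt_le hβ0 hβ1 hp hp1 hS₀ h0 (by omega)
  filter_upwards [ae_eventually_notMem hfin] with ω hω
  obtain ⟨N, hN⟩ := eventually_atTop.1 hω
  filter_upwards [eventually_ge_atTop (N + 1)] with t ht
  obtain ⟨s, rfl⟩ : ∃ s, t = s + 1 := ⟨t - 1, by omega⟩
  exact not_lt.1 (hN s (by omega))

theorem tendsto_rpow_mul_log_rpow {ε : ℝ} (hε : 0 < ε) :
    Tendsto (fun t : ℕ => (t : ℝ) ^ ((1 : ℝ) / 2) * Real.log t ^ ((1 : ℝ) / 2 + ε))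
      atTop atTop :=
  ((tendsto_rpow_atTop (by norm_num)).comp tendsto_natCast_atTop_atTop).atTop_mul_atTop₀
    ((tendsto_rpow_atTop (by linarith)).comp
      (Real.tendsto_log_atTop.comp tendsto_natCast_atTop_atTop))

theorem eventually_sqrt_mul_log_le {ε : ℝ} (hε : 0 < ε) :
    ∀ᶠ t : ℕ in atTop, 8 * √(t * Real.log t) ≤
      (t : ℝ) ^ ((1 : ℝ) / 2) * Real.log t ^ ((1 : ℝ) / 2 + ε) := by
  have hlog : Tendsto (fun t : ℕ => Real.log t) atTop atTop :=
    Real.tendsto_log_atTop.comp tendsto_natCast_atTop_atTop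
  filter_upwards [((tendsto_rpow_atTop hε).comp hlog).eventually_ge_atTop 8,
    hlog.eventually_gt_atTop 0] with t h8 hpos
  have h8 : 8 ≤ Real.log t ^ ε := h8
  rw [Real.sqrt_mul (Nat.cast_nonneg t), Real.rpow_add hpos, ← Real.sqrt_eq_rpow,
    ← Real.sqrt_eq_rpow]
  have : 0 ≤ √(t : ℝ) * √(Real.log t) := by positivity
  nlinarith

/-- Theorem 7(ii): for `β ∈ [0,1]` and `p ≥ 1/2`, a.s., for all but finitely many `t`,
`max_{0≤s≤t} |ξ_s| ≤ t^{1/2}(log t)^{1/2+ε}`. -/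
theorem hybridZone_max_upper_bound
    (β : ℝ) (hβ0 : 0 ≤ β) (hβ1 : β ≤ 1)
    (p : ℝ) (hp : 1 / 2 ≤ p) (hp1 : p ≤ 1)
    (S₀ : Word) (hS₀ : IsConfig S₀)
    {Ω : Type*} [MeasurableSpace Ω] (μ : Measure Ω) [IsProbabilityMeasure μ]
    (ξ : ℕ → Ω → Word) (hchain : IsEVChain β p μ ξ)
    (hinit : ∀ᵐ ω ∂μ, ξ 0 ω = S₀)
    (ε : ℝ) (hε : 0 < ε) :
    ∀ᵐ ω ∂μ, ∀ᶠ t : ℕ in atTop, ∀ s ≤ t,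
      (hz (ξ s ω) : ℝ) ≤ (t : ℝ) ^ ((1 : ℝ) / 2) * Real.log t ^ ((1 : ℝ) / 2 + ε) := by
  filter_upwards [hchain.ae_eventually_length_le hβ0 hβ1 hp hp1 hS₀ hinit] with ω hω
  obtain ⟨N, hN⟩ := eventually_atTop.1 hω
  filter_upwards [eventually_sqrt_mul_log_le hε,
    (tendsto_rpow_mul_log_rpow hε).eventually_ge_atTop
      (∑ s ∈ Finset.range (N + 1), (hz (ξ s ω) : ℝ))] with t h1 h2 s hs
  rcases lt_or_ge s (N + 1) with h | h
  · exact (Finset.single_le_sum (f := fun s => (hz (ξ s ω) : ℝ))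
      (fun i _ => Nat.cast_nonneg _) (Finset.mem_range.2 h)).trans h2
  · refine (hN s (by omega)).trans (le_trans ?_ h1)
    have hs1 : (1 : ℝ) ≤ s := by exact_mod_cast (by omega : 1 ≤ s)
    have hst : (s : ℝ) ≤ t := by exact_mod_cast hs
    have := Real.log_nonneg hs1
    gcongr

end EV
end

section
/- Suppose β = 0 and p = 1/2 (symmetric pure exclusion), and fix any initial configuration ξ₀ = S₀ ∈ 𝒟. Then for every ε > 0, Pr_{0,1/2}-almost surely, for all but finitely many t ∈ ℤ⁺, t^{1/3}(log t)^{−(1/3)−ε} ≤ max_{0 ≤ s ≤ t} |ξ_s| ≤ t^{1/2}(log t)^{(1/2)+ε}. -/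
open MeasureTheory Filter
open scoped ENNReal NNReal

namespace EV

/-- The number of `1`s in a word. -/
def ones : Word → ℕ
  | [] => 0
  | true :: w => ones w + 1
  | false :: w => ones w

/-- The number of `0`s in a word. -/
def zeros : Word → ℕ
  | [] => 0
  | true :: w => zeros w
  | false :: w => zeros w + 1

/-- The number of pairs consisting of a `0` and a `1` to its right. -/
def inversions : Word → ℕ
  | [] => 0
  | true :: w => inversions w
  | false :: w => inversions w + ones w

/-- Each `1` contributes the squared number of `0`s to its left, and each `0` the squared
number of `1`s to its right. -/
def energy : Word → ℕ
  | [] => 0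
  | true :: w => energy w
  | false :: w => energy w + 2 * inversions w + ones w + ones w ^ 2

theorem ones_append_false (w : Word) : ones (w ++ [false]) = ones w := by
  induction w with
  | nil => rfl
  | cons a w ih => cases a <;> simp [ones, ih]

theorem inversions_append_false (w : Word) : inversions (w ++ [false]) = inversions w := by
  induction w with
  | nil => rfl
  | cons a w ih => cases a <;> simp [inversions, ih, ones_append_false]

theorem energy_append_false (w : Word) : energy (w ++ [false]) = energy w := by
  induction w with
  | nil => rfl
  | cons a w ih => cases a <;> simp [energy, ih, ones_append_false, inversions_append_false]

theorem energy_pad (w : Word) : energy (pad w) = energy w := by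
  simp [pad, energy, energy_append_false]

theorem energy_dropWhile_true (w : Word) :
    energy (w.dropWhile (fun b => decide (b = true))) = energy w := by
  induction w with
  | nil => rfl
  | cons a w ih => cases a <;> simp_all [energy]

theorem energy_reverse_dropWhile_false (w : Word) :
    energy (w.dropWhile (fun b => decide (b = false))).reverse = energy w.reverse := by
  induction w with
  | nil => rfl
  | cons a w ih => cases a <;> simp_all [energy_append_false]

theorem energy_strip (w : Word) : energy (strip w) = energy w := by
  rw [strip, energy_reverse_dropWhile_false, List.reverse_reverse, energy_dropWhile_true]

theorem ones_add_zeros (w : Word) : ones w + zeros w = w.length := by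
  induction w with
  | nil => rfl
  | cons a w ih => cases a <;> simp [ones, zeros, ← ih] <;> omega

theorem ones_le_length (w : Word) : ones w ≤ w.length := by
  have := ones_add_zeros w
  omega

theorem inversions_le (w : Word) : inversions w ≤ w.length ^ 2 := by
  induction w with
  | nil => simp [inversions]
  | cons a w ih =>
    have := ones_le_length w
    cases a <;> simp only [inversions, List.length_cons] <;> nlinarith

theorem energy_le (w : Word) : energy w ≤ w.length ^ 3 := by
  induction w with
  | nil => simp [energy]
  | cons a w ih =>
    have h₁ := ones_le_length w
    have h₂ := inversions_le w
    have h₃ : ones w ^ 2 ≤ w.length ^ 2 := Nat.pow_le_pow_left h₁ 2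
    have h₄ : (w.length + 1) ^ 3 = w.length ^ 3 + 3 * w.length ^ 2 + 3 * w.length + 1 := by ring
    cases a <;> simp only [energy, List.length_cons, h₄] <;> omega

theorem sq_le_energy_of_getLast (w : Word) (hw : w.getLast? = some true) (z : ℕ) :
    (z + zeros w) ^ 2 ≤ energy w + 2 * z * inversions w + z ^ 2 * ones w := by
  induction w generalizing z with
  | nil => simp at hw
  | cons a w ih =>
    cases w with
    | nil =>
      have : a = true := by simpa using hw
      subst this
      simp [zeros, energy, inversions, ones]
    | cons b w =>
      rw [List.getLast?_cons_cons] at hw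
      cases a
      · have := ih hw (z + 1)
        simp only [zeros, energy, inversions, ones] at this ⊢
        nlinarith [Nat.zero_le (ones (b :: w) ^ 2)]
      · have := ih hw z
        simp only [zeros, energy, inversions, ones] at this ⊢
        nlinarith [Nat.zero_le (z ^ 2)]

theorem IsConfig.length_sq_le {w : Word} (hw : IsConfig w) : w.length ^ 2 ≤ 2 * energy w := by
  rcases hw with rfl | ⟨h₁, h₂⟩
  · simp
  · cases w with
    | nil => simp at h₁
    | cons a w =>
      have : a = false := by simpa using h₁
      subst this
      cases w with
      | nil => simp at h₂
      | cons b w =>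
        rw [List.getLast?_cons_cons] at h₂
        have h := sq_le_energy_of_getLast _ h₂ 1
        rw [List.length_cons, ← ones_add_zeros (b :: w), energy]
        generalize ones (b :: w) = x at *
        generalize zeros (b :: w) = y at *
        zify at h ⊢
        nlinarith [sq_nonneg ((x : ℤ) - (1 + y))]

theorem length_strip_le (w : Word) : (strip w).length ≤ w.length := by
  rw [strip, List.length_reverse]
  refine (List.dropWhile_sublist _).length_le.trans ?_
  rw [List.length_reverse]
  exact (List.dropWhile_sublist _).length_le

theorem length_strip_swapPair_pad_le (w : Word) (i : ℕ) :
    (strip (swapPair (pad w) i)).length ≤ w.length + 2 :=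
  (length_strip_le _).trans (by simp [swapPair, setPair, pad])

/-- The indices of the unlike adjacent pairs of a word that is not padded. -/
def unlikePairs (w : Word) : List ℕ :=
  (List.range (w.length - 1)).filter (fun i => w.getD i true ≠ w.getD (i + 1) true)

theorem unlike_eq_unlikePairs_pad (w : Word) : unlike w = unlikePairs (pad w) := by
  simp [unlike, unlikePairs, pad]

theorem unlikePairs_cons_cons (a b : Bool) (w : Word) :
    unlikePairs (a :: b :: w) =
      (if a ≠ b then [0] else []) ++ (unlikePairs (b :: w)).map Nat.succ := by
  simp only [unlikePairs, List.length_cons, Nat.add_sub_cancel, List.range_succ_eq_map,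
    List.filter_cons, List.filter_map]
  cases a <;> cases b <;> simp [Function.comp_def]

theorem swapPair_cons_succ (a : Bool) (w : Word) (i : ℕ) :
    swapPair (a :: w) (i + 1) = a :: swapPair w i := by
  simp [swapPair, setPair]

theorem swapPair_cons_cons_zero (a b : Bool) (w : Word) :
    swapPair (a :: b :: w) 0 = b :: a :: w := by
  simp [swapPair, setPair]

theorem ones_swapPair {w : Word} {i : ℕ} (hi : i ∈ unlikePairs w) :
    ones (swapPair w i) = ones w := by
  induction w generalizing i with
  | nil => simp [unlikePairs] at hi
  | cons a w ih =>
    cases w with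
    | nil => simp [unlikePairs] at hi
    | cons b w =>
      cases i with
      | zero => rw [swapPair_cons_cons_zero]; cases a <;> cases b <;> simp [ones]
      | succ i =>
        have hi' : i ∈ unlikePairs (b :: w) := by
          rw [unlikePairs_cons_cons] at hi
          split_ifs at hi <;> simpa using hi
        rw [swapPair_cons_succ]
        cases a <;> simp [ones, ih hi']

/-- The change of `energy + 2 * z * inversions` when the `i`-th pair is swapped. -/
def swapGain (z : ℤ) (w : Word) (i : ℕ) : ℤ :=
  (energy (swapPair w i) + 2 * z * inversions (swapPair w i)) - (energy w + 2 * z * inversions w)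

theorem swapGain_true_cons (z : ℤ) (w : Word) (i : ℕ) :
    swapGain z (true :: w) (i + 1) = swapGain z w i := by
  simp [swapGain, swapPair_cons_succ, energy, inversions]

theorem swapGain_false_cons (z : ℤ) {w : Word} {i : ℕ} (hi : i ∈ unlikePairs w) :
    swapGain z (false :: w) (i + 1) = swapGain (z + 1) w i := by
  simp only [swapGain, swapPair_cons_succ, energy, inversions, ones_swapPair hi]
  push_cast
  ring

theorem sum_swapGain (w : Word) (z : ℤ) (a : Bool) :
    ((unlikePairs (a :: (w ++ [false]))).map (swapGain z (a :: (w ++ [false])))).sum =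
      2 * (unlikePairs (a :: (w ++ [false]))).length + (if a then 2 * z else -2 * ones w) := by
  induction w generalizing z a with
  | nil =>
    cases a
    · simp [unlikePairs, ones]
    · simp [unlikePairs, swapGain, swapPair_cons_cons_zero, energy, inversions, ones]
  | cons b w ih =>
    rw [List.cons_append, unlikePairs_cons_cons]
    have h : ((unlikePairs (b :: (w ++ [false]))).map
        (fun i => swapGain z (a :: b :: (w ++ [false])) (i + 1))).sum =
        ((unlikePairs (b :: (w ++ [false]))).map
          (swapGain (if a then z else z + 1) (b :: (w ++ [false])))).sum := by
      congr 1
      refine List.map_congr_left fun i hi => ?_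
      cases a
      · simpa using swapGain_false_cons z hi
      · simpa using swapGain_true_cons z _ i
    simp only [List.map_append, List.map_map, List.sum_append, Function.comp_def,
      Nat.succ_eq_add_one, h, ih, List.length_append, List.length_map]
    cases a <;> cases b <;>
      simp [swapGain, swapPair_cons_cons_zero, energy, inversions, ones, ones_append_false] <;>
      ring

theorem unlike_ne_nil (w : Word) : unlike w ≠ [] := by
  rw [unlike_eq_unlikePairs_pad, pad]
  induction w with
  | nil => simp [unlikePairs]
  | cons a w ih =>
    rw [List.cons_append, unlikePairs_cons_cons]
    cases a <;> simp_all

theorem sum_energy_swapPair (w : Word) :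
    ((unlike w).map fun i => energy (strip (swapPair (pad w) i)) + energy w).sum =
      2 * (unlike w).length * (energy w + 1) := by
  have h := sum_swapGain w 0 true
  rw [← pad, ← unlike_eq_unlikePairs_pad] at h
  have key : ∀ l : List ℕ,
      (((l.map fun i => energy (strip (swapPair (pad w) i)) + energy w).sum : ℕ) : ℤ) =
        (l.map (swapGain 0 (pad w))).sum + 2 * l.length * energy w := by
    intro l
    induction l with
    | nil => simp
    | cons i l ih =>
      rw [List.map_cons, List.sum_cons, Nat.cast_add, ih]
      simp only [List.map_cons, List.sum_cons, List.length_cons, swapGain, energy_strip,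
        energy_pad]
      push_cast
      ring
  have h' := key (unlike w)
  rw [h] at h'
  simp only [reduceIte, mul_zero, add_zero] at h'
  apply Nat.cast_injective (R := ℤ)
  rw [h']
  push_cast
  ring

/-- The transition operator of the symmetric pure exclusion chain. -/
noncomputable def transitionOp (h : Word → ℝ≥0∞) (w : Word) : ℝ≥0∞ :=
  ∑' w', ENNReal.ofReal (P 0 (1 / 2) w w') * h w'

theorem tsum_ofReal_list_sum_mul {ι : Type*} (l : List ι) (q : ι → Word → ℝ)
    (hq : ∀ i w, 0 ≤ q i w) (h : Word → ℝ≥0∞) :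
    ∑' w, ENNReal.ofReal ((l.map fun i => q i w).sum) * h w =
      (l.map fun i => ∑' w, ENNReal.ofReal (q i w) * h w).sum := by
  induction l with
  | nil => simp
  | cons i l ih =>
    have hl : ∀ w, 0 ≤ (l.map fun i => q i w).sum := fun w =>
      List.sum_nonneg (by simpa using fun i _ => hq i w)
    simp only [List.map_cons, List.sum_cons, ENNReal.ofReal_add (hq i _) (hl _), add_mul]
    rw [ENNReal.tsum_add, ih]

theorem transitionOp_eq (h : Word → ℝ≥0∞) (w : Word) :
    transitionOp h w =
      ((unlike w).map fun i => (2 * (unlike w).length : ℝ≥0∞)⁻¹ *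
        (h (strip (swapPair (pad w) i)) + h w)).sum := by
  set n := (unlike w).length with hn
  have hn0 : 0 < n := List.length_pos_iff.mpr (unlike_ne_nil w)
  have hP : ∀ w', P 0 (1 / 2) w w' = ((unlike w).map fun i =>
      ((2 * n : ℝ)⁻¹ * (if strip (swapPair (pad w) i) = w' then 1 else 0) +
        (2 * n : ℝ)⁻¹ * (if w = w' then 1 else 0))).sum := by
    intro w'
    rw [P]
    congr 1
    refine List.map_congr_left fun i _ => ?_
    rw [← hn, mul_inv]
    simp only [show (1 : ℝ) - 1 / 2 = 1 / 2 by norm_num, ite_self]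
    ring
  have hc : ENNReal.ofReal (2 * n : ℝ)⁻¹ = (2 * n : ℝ≥0∞)⁻¹ := by
    rw [ENNReal.ofReal_inv_of_pos (by positivity), ENNReal.ofReal_mul (by norm_num)]
    simp
  rw [transitionOp]
  simp_rw [hP]
  rw [tsum_ofReal_list_sum_mul]
  · congr 1
    refine List.map_congr_left fun i _ => ?_
    have hs : ∀ s : Word, ∑' w', ENNReal.ofReal ((2 * n : ℝ)⁻¹ * (if s = w' then 1 else 0)) * h w'
        = (2 * n : ℝ≥0∞)⁻¹ * h s := by
      intro s
      rw [tsum_eq_single s]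
      · rw [if_pos rfl, mul_one, hc]
      · intro w' hw'
        simp [hw'.symm]
    rw [mul_add, ← hs, ← hs, ← ENNReal.tsum_add]
    refine tsum_congr fun w' => ?_
    rw [ENNReal.ofReal_add (by positivity) (by positivity), add_mul]
  · intro i w'
    positivity

theorem transitionOp_mono {h h' : Word → ℝ≥0∞} {w : Word} (hw : h w ≤ h' w)
    (hs : ∀ i, h (strip (swapPair (pad w) i)) ≤ h' (strip (swapPair (pad w) i))) :
    transitionOp h w ≤ transitionOp h' w := by
  rw [transitionOp_eq, transitionOp_eq]
  refine List.sum_le_sum fun i _ => ?_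
  gcongr
  exact hs i

theorem transitionOp_energy (w : Word) :
    transitionOp (fun w => (energy w : ℝ≥0∞)) w = energy w + 1 := by
  have hn0 : ((unlike w).length : ℝ≥0∞) ≠ 0 := by
    simpa using unlike_ne_nil w
  rw [transitionOp_eq, List.sum_map_mul_left]
  have h := congrArg (Nat.cast : ℕ → ℝ≥0∞) (sum_energy_swapPair w)
  rw [Nat.cast_list_sum, List.map_map] at h
  simp only [Function.comp_def, Nat.cast_add, Nat.cast_mul, Nat.cast_ofNat, Nat.cast_one] at h
  rw [h, ← mul_assoc, ENNReal.inv_mul_cancel, one_mul]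
  · simpa using unlike_ne_nil w
  · exact ENNReal.mul_ne_top (by simp) (by simp)

theorem transitionOp_not_isConfig {w : Word} (hw : IsConfig w) :
    transitionOp ({w | ¬ IsConfig w}.indicator 1) w = 0 := by
  rw [transitionOp_eq, List.sum_eq_zero]
  simp [isConfig_strip, hw]

/-- The event that the chain stays in `C` up to time `t`. -/
def staysIn {Ω : Type*} (ξ : ℕ → Ω → Word) (C : Set Word) (t : ℕ) : Set Ω :=
  {ω | ∀ s ≤ t, ξ s ω ∈ C}

theorem staysIn_antitone {Ω : Type*} {ξ : ℕ → Ω → Word} (C : Set Word) :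
    Antitone (staysIn ξ C) :=
  fun _ _ hst _ h s hs => h s (hs.trans hst)

section Chain

variable {Ω : Type*} [MeasurableSpace Ω] {μ : Measure Ω} {ξ : ℕ → Ω → Word}

theorem IsEVChain.lintegral_succ_s10 (hchain : IsEVChain 0 (1 / 2) μ ξ) (t : ℕ)
    (F : (Fin (t + 1) → Word) → ℝ≥0∞) (h : Word → ℝ≥0∞) :
    ∫⁻ ω, F (fun i => ξ i ω) * h (ξ (t + 1) ω) ∂μ =
      ∫⁻ ω, F (fun i => ξ i ω) * transitionOp h (ξ t ω) ∂μ := by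
  obtain ⟨hmeas, hpath⟩ := hchain
  have hX : Measurable fun ω (i : Fin (t + 1)) => ξ i ω :=
    measurable_pi_lambda _ fun i => hmeas i
  have hpair : Measurable fun ω => ((fun i : Fin (t + 1) => ξ i ω), ξ (t + 1) ω) :=
    hX.prodMk (hmeas _)
  have hstep : ∀ (y : Fin (t + 1) → Word) (w : Word),
      μ ((fun ω => ((fun i : Fin (t + 1) => ξ i ω), ξ (t + 1) ω)) ⁻¹' {(y, w)}) =
        μ ((fun ω (i : Fin (t + 1)) => ξ i ω) ⁻¹' {y}) *
          ENNReal.ofReal (P 0 (1 / 2) (y (Fin.last t)) w) := by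
    intro y w
    have h := hpath t fun i => if hi : i < t + 1 then y ⟨i, hi⟩ else w
    rw [dif_pos (Nat.lt_succ_self t), dif_neg (lt_irrefl _)] at h
    convert h using 3
    · ext ω
      simp only [Set.mem_preimage, Set.mem_singleton_iff, Prod.mk.injEq, Set.mem_ofPred_eq,
        funext_iff]
      constructor
      · rintro ⟨h₁, h₂⟩ i hi
        split_ifs with hi'
        · exact h₁ ⟨i, hi'⟩
        · rw [show i = t + 1 by omega, h₂]
      · intro h
        refine ⟨fun i => ?_, by simpa using h (t + 1) le_rfl⟩
        rw [h i (by omega), dif_pos i.2]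
    · ext ω
      simp only [Set.mem_preimage, Set.mem_singleton_iff, Set.mem_ofPred_eq, funext_iff]
      constructor
      · intro h i hi
        rw [dif_pos (by omega)]
        exact h ⟨i, by omega⟩
      · intro h i
        rw [h i (by omega), dif_pos i.2]
    · rfl
  have hR : ∫⁻ ω, F (fun i => ξ i ω) * transitionOp h (ξ t ω) ∂μ =
      ∫⁻ y, F y * transitionOp h (y (Fin.last t)) ∂(μ.map fun ω (i : Fin (t + 1)) => ξ i ω) := by
    rw [lintegral_map (measurable_of_countable _) hX]
    simp
  have hL : ∫⁻ ω, F (fun i => ξ i ω) * h (ξ (t + 1) ω) ∂μ =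
      ∫⁻ y, F y.1 * h y.2 ∂(μ.map fun ω => ((fun i : Fin (t + 1) => ξ i ω), ξ (t + 1) ω)) := by
    rw [lintegral_map (measurable_of_countable _) hpair]
  rw [hL, hR, lintegral_countable', lintegral_countable', ENNReal.tsum_prod']
  refine tsum_congr fun y => ?_
  rw [Measure.map_apply hX (measurableSet_singleton _), transitionOp, ← ENNReal.tsum_mul_left,
    ← ENNReal.tsum_mul_right]
  refine tsum_congr fun w => ?_
  rw [Measure.map_apply hpair (measurableSet_singleton _), hstep]
  ring

theorem measurableSet_staysIn (hξ : ∀ t, Measurable (ξ t)) (C : Set Word) (t : ℕ) :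
    MeasurableSet (staysIn ξ C t) := by
  have : staysIn ξ C t = ⋂ s, ⋂ (_ : s ≤ t), ξ s ⁻¹' C := by
    ext ω
    simp [staysIn]
  rw [this]
  exact MeasurableSet.iInter fun s => MeasurableSet.iInter fun _ => hξ s trivial

theorem IsEVChain.setLIntegral_succ (hchain : IsEVChain 0 (1 / 2) μ ξ) (C : Set Word) (t : ℕ)
    (h : Word → ℝ≥0∞) :
    ∫⁻ ω in staysIn ξ C t, h (ξ (t + 1) ω) ∂μ =
      ∫⁻ ω in staysIn ξ C t, transitionOp h (ξ t ω) ∂μ := by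
  have hF := hchain.lintegral_succ_s10 t ({y | ∀ i, y i ∈ C}.indicator 1) h
  have hmem : ∀ ω, ((fun i : Fin (t + 1) => ξ i ω) ∈ {y : Fin (t + 1) → Word | ∀ i, y i ∈ C}) ↔
      ω ∈ staysIn ξ C t := fun ω =>
    ⟨fun h s hs => h ⟨s, by omega⟩, fun h i => h i (by omega)⟩
  rw [← lintegral_indicator (measurableSet_staysIn hchain.1 C t),
    ← lintegral_indicator (measurableSet_staysIn hchain.1 C t)]
  convert hF using 3 with ω ω
  · by_cases hω : ω ∈ staysIn ξ C t
    · rw [Set.indicator_of_mem hω, Set.indicator_of_mem ((hmem ω).2 hω)]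
      simp
    · rw [Set.indicator_of_notMem hω, Set.indicator_of_notMem (mt (hmem ω).1 hω)]
      simp
  · by_cases hω : ω ∈ staysIn ξ C t
    · rw [Set.indicator_of_mem hω, Set.indicator_of_mem ((hmem ω).2 hω)]
      simp
    · rw [Set.indicator_of_notMem hω, Set.indicator_of_notMem (mt (hmem ω).1 hω)]
      simp

theorem IsEVChain.ae_isConfig_s10 (hchain : IsEVChain 0 (1 / 2) μ ξ)
    (h₀ : ∀ᵐ ω ∂μ, IsConfig (ξ 0 ω)) : ∀ᵐ ω ∂μ, ∀ t, IsConfig (ξ t ω) := by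
  rw [ae_all_iff]
  intro t
  induction t with
  | zero => exact h₀
  | succ t ih =>
    have h := hchain.setLIntegral_succ Set.univ t ({w | ¬ IsConfig w}.indicator 1)
    have huniv : staysIn ξ Set.univ t = Set.univ := by simp [staysIn]
    rw [huniv, setLIntegral_univ, setLIntegral_univ] at h
    have hzero : ∫⁻ ω, transitionOp ({w | ¬ IsConfig w}.indicator 1) (ξ t ω) ∂μ = 0 := by
      rw [lintegral_congr_ae (g := 0)]
      · simp
      · filter_upwards [ih] with ω hω using transitionOp_not_isConfig hω
    have hind : Measurable fun ω => {w | ¬ IsConfig w}.indicator (1 : Word → ℝ≥0∞) (ξ (t + 1) ω) :=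
      (measurable_of_countable ({w | ¬ IsConfig w}.indicator (1 : Word → ℝ≥0∞))).comp
        (hchain.1 (t + 1))
    rw [hzero, lintegral_eq_zero_iff hind] at h
    filter_upwards [h] with ω hω
    by_contra hc
    simp [hc] at hω

/-- The expectation of `V` along the chain, frozen at the value `M` after the exit from `C`. -/
noncomputable def frozenMean (μ : Measure Ω) (ξ : ℕ → Ω → Word) (C : Set Word)
    (V : Word → ℝ≥0∞) (M : ℝ≥0∞) (t : ℕ) : ℝ≥0∞ :=
  ∫⁻ ω in staysIn ξ C t, V (ξ t ω) ∂μ + M * μ (staysIn ξ C t)ᶜ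

theorem IsEVChain.frozenMean_succ (hchain : IsEVChain 0 (1 / 2) μ ξ) {C : Set Word}
    {V : Word → ℝ≥0∞} {M : ℝ≥0∞} (hV : ∀ w ∉ C, V w = M) (t : ℕ) :
    frozenMean μ ξ C V M (t + 1) =
      ∫⁻ ω in staysIn ξ C t, transitionOp V (ξ t ω) ∂μ + M * μ (staysIn ξ C t)ᶜ := by
  have hA := measurableSet_staysIn hchain.1 C t
  have hA' := measurableSet_staysIn hchain.1 C (t + 1)
  have hsub : staysIn ξ C (t + 1) ⊆ staysIn ξ C t := staysIn_antitone C (Nat.le_succ t)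
  have hdiff : ∀ ω ∈ staysIn ξ C t \ staysIn ξ C (t + 1), V (ξ (t + 1) ω) = M := by
    rintro ω ⟨h₁, h₂⟩
    refine hV _ fun hmem => h₂ fun s hs => ?_
    rcases Nat.le_succ_iff.1 hs with hs | rfl
    · exact h₁ s hs
    · exact hmem
  rw [← hchain.setLIntegral_succ, ← lintegral_inter_add_sdiff _ (staysIn ξ C t) hA',
    Set.inter_eq_self_of_subset_right hsub, setLIntegral_congr_fun (hA.diff hA') hdiff,
    setLIntegral_const, add_assoc, ← mul_add, frozenMean, add_comm (μ (_ \ _))]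
  congr 2
  rw [← measure_union _ (hA.diff hA')]
  · congr 1
    ext ω
    have := @hsub ω
    simp only [Set.mem_compl_iff, Set.mem_union, Set.mem_sdiff]
    tauto
  · rw [Set.disjoint_left]
    rintro ω h₁ ⟨h₂, -⟩
    exact h₁ h₂

variable [IsProbabilityMeasure μ]

theorem IsEVChain.mul_measure_staysIn_le (hchain : IsEVChain 0 (1 / 2) μ ξ) {C : Set Word}
    {V : Word → ℝ≥0∞} {M : ℝ≥0∞} (hV : ∀ w ∉ C, V w = M) (hVM : ∀ w, V w ≤ M)
    (hdrift : ∀ w ∈ C, V w + 1 ≤ transitionOp V w) (t : ℕ) :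
    t * μ (staysIn ξ C t) ≤ M := by
  have hle : ∀ t : ℕ, t * μ (staysIn ξ C t) ≤ frozenMean μ ξ C V M t := by
    intro t
    induction t with
    | zero => simp
    | succ t ih =>
      have hA := measurableSet_staysIn hchain.1 C t
      rw [hchain.frozenMean_succ hV]
      calc ((t + 1 : ℕ) : ℝ≥0∞) * μ (staysIn ξ C (t + 1))
          ≤ (t + 1 : ℕ) * μ (staysIn ξ C t) := by
            gcongr
            exact staysIn_antitone C (Nat.le_succ t)
        _ = t * μ (staysIn ξ C t) + μ (staysIn ξ C t) := by push_cast; ring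
        _ ≤ frozenMean μ ξ C V M t + μ (staysIn ξ C t) := by gcongr
        _ = ∫⁻ ω in staysIn ξ C t, (V (ξ t ω) + 1) ∂μ + M * μ (staysIn ξ C t)ᶜ := by
            rw [lintegral_add_right _ measurable_const, setLIntegral_one, frozenMean]
            ring
        _ ≤ _ := by
            gcongr ?_ + _
            exact setLIntegral_mono' hA fun ω hω => hdrift _ (hω t le_rfl)
  refine (hle t).trans ?_
  have hA := measurableSet_staysIn hchain.1 C t
  calc frozenMean μ ξ C V M t
      ≤ ∫⁻ _ in staysIn ξ C t, M ∂μ + M * μ (staysIn ξ C t)ᶜ := by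
        rw [frozenMean]
        gcongr
        exact hVM _
    _ = M := by
        rw [setLIntegral_const, ← mul_add, measure_add_measure_compl hA, measure_univ, mul_one]

theorem IsEVChain.mul_measure_compl_staysIn_le (hchain : IsEVChain 0 (1 / 2) μ ξ) {C : Set Word}
    {V : Word → ℝ≥0∞} {M : ℝ≥0∞} (hV : ∀ w ∉ C, V w = M)
    (hdrift : ∀ w ∈ C, transitionOp V w ≤ V w + 1) (t : ℕ) :
    M * μ (staysIn ξ C t)ᶜ ≤ ∫⁻ ω, V (ξ 0 ω) ∂μ + t := by
  have hle : ∀ t : ℕ, frozenMean μ ξ C V M t ≤ ∫⁻ ω, V (ξ 0 ω) ∂μ + t := by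
    intro t
    induction t with
    | zero =>
      have hA := measurableSet_staysIn hchain.1 C 0
      have hsplit := lintegral_add_compl (μ := μ) (fun ω => V (ξ 0 ω)) hA
      rw [frozenMean, ← setLIntegral_const, Nat.cast_zero, add_zero, ← hsplit]
      refine add_le_add le_rfl ?_
      refine (setLIntegral_congr_fun hA.compl fun ω hω => ?_).le
      refine (hV _ fun h => hω fun s hs => ?_).symm
      rwa [Nat.le_zero.1 hs]
    | succ t ih =>
      have hA := measurableSet_staysIn hchain.1 C t
      rw [hchain.frozenMean_succ hV]
      calc ∫⁻ ω in staysIn ξ C t, transitionOp V (ξ t ω) ∂μ + M * μ (staysIn ξ C t)ᶜ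
          ≤ ∫⁻ ω in staysIn ξ C t, (V (ξ t ω) + 1) ∂μ + M * μ (staysIn ξ C t)ᶜ := by
            gcongr ?_ + _
            exact setLIntegral_mono' hA fun ω hω => hdrift _ (hω t le_rfl)
        _ = frozenMean μ ξ C V M t + μ (staysIn ξ C t) := by
            rw [lintegral_add_right _ measurable_const, setLIntegral_one, frozenMean]
            ring
        _ ≤ ∫⁻ ω, V (ξ 0 ω) ∂μ + t + 1 := by
            gcongr
            exact prob_le_one
        _ = _ := by push_cast; ring
  exact le_trans (by rw [frozenMean]; exact le_add_self) (hle t)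

theorem IsEVChain.measure_length_le (hchain : IsEVChain 0 (1 / 2) μ ξ) (n t : ℕ) :
    t * μ {ω | ∀ s ≤ t, (ξ s ω).length ≤ n} ≤ ((n + 2) ^ 3 : ℕ) := by
  classical
  refine hchain.mul_measure_staysIn_le (C := {w | w.length ≤ n})
    (V := fun w => if w.length ≤ n then (energy w : ℝ≥0∞) else ((n + 2) ^ 3 : ℕ)) ?_ ?_ ?_ t
  · intro w hw
    exact if_neg hw
  · intro w
    split_ifs with hw
    · exact_mod_cast (energy_le w).trans (Nat.pow_le_pow_left (by omega) 3)
    · exact le_rfl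
  · intro w hw
    have hw' : w.length ≤ n := hw
    rw [if_pos hw', ← transitionOp_energy]
    refine transitionOp_mono (by rw [if_pos hw']) fun i => ?_
    split_ifs with hi
    · exact le_rfl
    · have := length_strip_swapPair_pad_le w i
      exact_mod_cast (energy_le _).trans (Nat.pow_le_pow_left (by omega) 3)

theorem IsEVChain.measure_le_energy (hchain : IsEVChain 0 (1 / 2) μ ξ) {S₀ : Word}
    (hinit : ∀ᵐ ω ∂μ, ξ 0 ω = S₀) (M : ℝ≥0∞) (t : ℕ) :
    M * μ {ω | ∃ s ≤ t, M ≤ energy (ξ s ω)} ≤ energy S₀ + t := by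
  have h := hchain.mul_measure_compl_staysIn_le (C := {w | (energy w : ℝ≥0∞) < M})
    (V := fun w => min (energy w : ℝ≥0∞) M) (M := M) ?_ ?_ t
  · have hset : (staysIn ξ {w | (energy w : ℝ≥0∞) < M} t)ᶜ =
        {ω | ∃ s ≤ t, M ≤ energy (ξ s ω)} := by
      ext ω
      simp [staysIn]
    rw [hset] at h
    refine h.trans ?_
    gcongr
    calc ∫⁻ ω, min (energy (ξ 0 ω) : ℝ≥0∞) M ∂μ ≤ ∫⁻ _, (energy S₀ : ℝ≥0∞) ∂μ := by
          refine lintegral_mono_ae ?_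
          filter_upwards [hinit] with ω hω
          rw [hω]
          exact min_le_left _ _
      _ = energy S₀ := by simp
  · intro w hw
    exact min_eq_right (not_lt.1 hw)
  · intro w hw
    have hw' : (energy w : ℝ≥0∞) < M := hw
    rw [min_eq_left hw'.le, ← transitionOp_energy]
    exact transitionOp_mono (min_le_left _ _) fun _ => min_le_left _ _

end Chain

theorem le_ofReal_div_of_ofReal_mul_le {m b : ℝ} (hm : 0 < m) {x : ℝ≥0∞}
    (h : ENNReal.ofReal m * x ≤ ENNReal.ofReal b) : x ≤ ENNReal.ofReal (b / m) := by
  rw [ENNReal.ofReal_div_of_pos hm, ENNReal.le_div_iff_mul_le (by simp [hm]) (by simp), mul_comm]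
  exact h

theorem summable_inv_succ_rpow {ε : ℝ} (hε : 0 < ε) :
    Summable fun k : ℕ => (((k : ℝ) + 1) ^ (1 + ε))⁻¹ := by
  have h := (summable_nat_add_iff 1).2 (Real.summable_nat_rpow_inv.2 (by linarith : 1 < 1 + ε))
  simpa using h

theorem eventually_two_mul_rpow_le {ε : ℝ} (hε : 0 < ε) :
    ∀ᶠ L : ℝ in atTop, 2 * (4 * L) ^ (1 + ε) ≤ L ^ (1 + 2 * ε) := by
  filter_upwards [(tendsto_rpow_atTop hε).eventually_ge_atTop (2 * 4 ^ (1 + ε)),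
    eventually_gt_atTop 0] with L hL hL0
  rw [Real.mul_rpow (by norm_num) hL0.le, show 1 + 2 * ε = ε + (1 + ε) by ring,
    Real.rpow_add hL0 ε (1 + ε), ← mul_assoc]
  exact mul_le_mul_of_nonneg_right hL (by positivity)

theorem natLog_succ_le {t : ℕ} (ht : 1 ≤ Real.log t) : (Nat.log 2 t : ℝ) + 1 ≤ 4 * Real.log t := by
  have ht0 : t ≠ 0 := by
    rintro rfl
    simp at ht
    linarith
  have h₁ : ((2 : ℝ) ^ Nat.log 2 t) ≤ t := by exact_mod_cast Nat.pow_log_le_self 2 ht0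
  have h₂ := Real.log_le_log (by positivity) h₁
  rw [Real.log_pow] at h₂
  nlinarith [Real.log_two_gt_d9, (Nat.cast_nonneg (Nat.log 2 t) : (0 : ℝ) ≤ _)]

theorem lower_threshold_le {ε t L : ℝ} (hε : 0 < ε) (ht : 0 ≤ t) (hL : 1 ≤ L) {k : ℕ}
    (htk : t ≤ 2 * 2 ^ k) (hkL : (k : ℝ) + 1 ≤ 4 * L)
    (hgrow : 2 * (4 * L) ^ (1 + ε) ≤ L ^ (1 + 2 * ε)) :
    t ^ ((1 : ℝ) / 3) * L ^ (-(1 : ℝ) / 3 - ε) ≤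
      (2 ^ k / ((k : ℝ) + 1) ^ (1 + ε)) ^ ((1 : ℝ) / 3) := by
  have hL0 : 0 < L := by linarith
  rw [show -(1 : ℝ) / 3 - ε = -(1 + 3 * ε) * (1 / 3) by ring, Real.rpow_mul hL0.le,
    ← Real.mul_rpow ht (by positivity)]
  refine Real.rpow_le_rpow (by positivity) ?_ (by norm_num)
  rw [Real.rpow_neg hL0.le, ← div_eq_mul_inv, div_le_div_iff₀ (by positivity) (by positivity)]
  calc t * ((k : ℝ) + 1) ^ (1 + ε) ≤ (2 * 2 ^ k) * (4 * L) ^ (1 + ε) := by gcongr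
    _ = 2 ^ k * (2 * (4 * L) ^ (1 + ε)) := by ring
    _ ≤ 2 ^ k * L ^ (1 + 2 * ε) := by gcongr
    _ ≤ 2 ^ k * L ^ (1 + 3 * ε) := by
      refine mul_le_mul_of_nonneg_left ?_ (by positivity)
      exact Real.rpow_le_rpow_of_exponent_le hL (by linarith)

theorem le_upper_threshold {ε t L x e : ℝ} (hε : 0 < ε) (hL : 1 ≤ L) {k : ℕ}
    (hkt : 2 ^ k ≤ t) (hkL : (k : ℝ) + 1 ≤ 4 * L)
    (hgrow : 2 * (4 * L) ^ (1 + ε) ≤ L ^ (1 + 2 * ε))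
    (hxe : x ^ 2 ≤ 2 * e) (he : e ≤ 2 ^ k * ((k : ℝ) + 1) ^ (1 + ε)) :
    x ≤ t ^ ((1 : ℝ) / 2) * L ^ ((1 : ℝ) / 2 + ε) := by
  have hL0 : 0 < L := by linarith
  have ht : 0 ≤ t := le_trans (by positivity) hkt
  rw [show (1 : ℝ) / 2 + ε = (1 + 2 * ε) * (1 / 2) by ring, Real.rpow_mul hL0.le,
    ← Real.mul_rpow ht (by positivity), ← Real.sqrt_eq_rpow]
  refine Real.le_sqrt_of_sq_le ?_
  calc x ^ 2 ≤ 2 * (2 ^ k * ((k : ℝ) + 1) ^ (1 + ε)) := by linarith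
    _ ≤ 2 * (t * (4 * L) ^ (1 + ε)) := by gcongr
    _ = t * (2 * (4 * L) ^ (1 + ε)) := by ring
    _ ≤ t * L ^ (1 + 2 * ε) := by gcongr

section Chain

variable {Ω : Type*} [MeasurableSpace Ω] {μ : Measure Ω} [IsProbabilityMeasure μ]
  {ξ : ℕ → Ω → Word}

theorem IsEVChain.ae_eventually_lt_length (hchain : IsEVChain 0 (1 / 2) μ ξ) {ε : ℝ}
    (hε : 0 < ε) :
    ∀ᵐ ω ∂μ, ∀ᶠ k : ℕ in atTop, ∃ s ≤ 2 ^ k,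
      (2 ^ k / ((k : ℝ) + 1) ^ (1 + ε)) ^ ((1 : ℝ) / 3) < (ξ s ω).length := by
  set x : ℕ → ℝ := fun k => (2 ^ k / ((k : ℝ) + 1) ^ (1 + ε)) ^ ((1 : ℝ) / 3)
  have hx0 : ∀ k, 0 ≤ x k := fun k => by positivity
  have hx3 : ∀ k, x k ^ 3 = 2 ^ k / ((k : ℝ) + 1) ^ (1 + ε) := by
    intro k
    rw [← Real.rpow_natCast, ← Real.rpow_mul (by positivity)]
    norm_num
  have hbound : ∀ k : ℕ, μ {ω | ∀ s ≤ 2 ^ k, (ξ s ω).length ≤ ⌊x k⌋₊} ≤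
      ENNReal.ofReal (4 * (((k : ℝ) + 1) ^ (1 + ε))⁻¹ + 32 * (1 / 2) ^ k) := by
    intro k
    have h := hchain.measure_length_le ⌊x k⌋₊ (2 ^ k)
    refine (le_ofReal_div_of_ofReal_mul_le (m := 2 ^ k) (b := ((⌊x k⌋₊ + 2) ^ 3 : ℕ)) (by positivity)
      ?_).trans (ENNReal.ofReal_le_ofReal ?_)
    · rw [ENNReal.ofReal_natCast]
      convert h using 2
      rw [← ENNReal.ofReal_natCast]
      simp
    · rw [div_le_iff₀ (by positivity)]
      have hfloor := Nat.floor_le (hx0 k)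
      have hpow : (32 * (1 / 2) ^ k) * (2 : ℝ) ^ k = 32 := by
        rw [mul_assoc, ← mul_pow]
        norm_num
      have hdiv : 4 * (((k : ℝ) + 1) ^ (1 + ε))⁻¹ * 2 ^ k = 4 * x k ^ 3 := by
        rw [hx3]
        ring
      rw [add_mul, hpow, hdiv]
      push_cast
      calc ((⌊x k⌋₊ : ℝ) + 2) ^ 3 ≤ (x k + 2) ^ 3 := by gcongr
        _ ≤ 4 * x k ^ 3 + 32 := by
          nlinarith [mul_nonneg (add_nonneg (hx0 k) zero_le_two) (sq_nonneg (x k - 2))]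
  have hsum : Summable fun k : ℕ => 4 * (((k : ℝ) + 1) ^ (1 + ε))⁻¹ + 32 * (1 / 2) ^ k :=
    ((summable_inv_succ_rpow hε).mul_left 4).add (summable_geometric_two.mul_left 32)
  have htop := ne_top_of_le_ne_top hsum.tsum_ofReal_ne_top (ENNReal.tsum_le_tsum hbound)
  filter_upwards [ae_eventually_notMem htop] with ω hω
  filter_upwards [hω] with k hk
  simp only [not_forall, not_le] at hk
  obtain ⟨s, hs, hlt⟩ := hk
  exact ⟨s, hs, Nat.lt_of_floor_lt hlt⟩

theorem IsEVChain.ae_eventually_energy_lt (hchain : IsEVChain 0 (1 / 2) μ ξ) {S₀ : Word}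
    (hinit : ∀ᵐ ω ∂μ, ξ 0 ω = S₀) {ε : ℝ} (hε : 0 < ε) :
    ∀ᵐ ω ∂μ, ∀ᶠ k : ℕ in atTop, ∀ s ≤ 2 ^ (k + 1),
      (energy (ξ s ω) : ℝ) < 2 ^ k * ((k : ℝ) + 1) ^ (1 + ε) := by
  set m : ℕ → ℝ := fun k => 2 ^ k * ((k : ℝ) + 1) ^ (1 + ε) with hm
  have hm0 : ∀ k, 0 < m k := fun k => by positivity
  have hbound : ∀ k : ℕ,
      μ {ω | ∃ s ≤ 2 ^ (k + 1), ENNReal.ofReal (m k) ≤ energy (ξ s ω)} ≤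
        ENNReal.ofReal ((energy S₀ + 2) * (((k : ℝ) + 1) ^ (1 + ε))⁻¹) := by
    intro k
    have h := hchain.measure_le_energy hinit (ENNReal.ofReal (m k)) (2 ^ (k + 1))
    refine (le_ofReal_div_of_ofReal_mul_le (b := (energy S₀ + 2 ^ (k + 1) : ℕ)) (hm0 k)
      ?_).trans (ENNReal.ofReal_le_ofReal ?_)
    · rw [ENNReal.ofReal_natCast]
      exact_mod_cast h
    · rw [div_le_iff₀ (hm0 k)]
      have hcancel : ((energy S₀ : ℝ) + 2) * (((k : ℝ) + 1) ^ (1 + ε))⁻¹ * m k =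
          (energy S₀ + 2) * 2 ^ k := by
        rw [hm]
        field_simp
      rw [hcancel]
      push_cast
      have h1 : (1 : ℝ) ≤ 2 ^ k := one_le_pow₀ one_le_two
      rw [pow_succ]
      nlinarith [(Nat.cast_nonneg (energy S₀) : (0 : ℝ) ≤ _)]
  have hsum := (summable_inv_succ_rpow hε).mul_left ((energy S₀ : ℝ) + 2)
  have htop := ne_top_of_le_ne_top hsum.tsum_ofReal_ne_top (ENNReal.tsum_le_tsum hbound)
  filter_upwards [ae_eventually_notMem htop] with ω hω
  filter_upwards [hω] with k hk s hs
  by_contra! hle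
  refine hk ⟨s, hs, ?_⟩
  rw [← ENNReal.ofReal_natCast]
  exact ENNReal.ofReal_le_ofReal hle

end Chain

/-- Theorem 9: for symmetric pure exclusion (`β = 0`, `p = 1/2`), a.s., for all but
finitely many `t`, `t^{1/3}(log t)^{-1/3-ε} ≤ max_{0≤s≤t} |ξ_s| ≤ t^{1/2}(log t)^{1/2+ε}`. -/
theorem hybridZone_bounds_symmetric_pure_exclusion
    (S₀ : Word) (hS₀ : IsConfig S₀)
    {Ω : Type*} [MeasurableSpace Ω] (μ : Measure Ω) [IsProbabilityMeasure μ]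
    (ξ : ℕ → Ω → Word) (hchain : IsEVChain 0 (1 / 2) μ ξ)
    (hinit : ∀ᵐ ω ∂μ, ξ 0 ω = S₀)
    (ε : ℝ) (hε : 0 < ε) :
    ∀ᵐ ω ∂μ, ∀ᶠ t : ℕ in atTop,
      (∃ s ≤ t, (t : ℝ) ^ ((1 : ℝ) / 3) * Real.log t ^ (-(1 : ℝ) / 3 - ε) ≤ (hz (ξ s ω) : ℝ)) ∧
      (∀ s ≤ t, (hz (ξ s ω) : ℝ) ≤ (t : ℝ) ^ ((1 : ℝ) / 2) * Real.log t ^ ((1 : ℝ) / 2 + ε)) := by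
  have hconf : ∀ᵐ ω ∂μ, ∀ t, IsConfig (ξ t ω) := by
    refine hchain.ae_isConfig_s10 ?_
    filter_upwards [hinit] with ω hω
    rwa [hω]
  have hlog : Tendsto (fun t : ℕ => Real.log t) atTop atTop :=
    Real.tendsto_log_atTop.comp tendsto_natCast_atTop_atTop
  have hNatLog : Tendsto (fun t : ℕ => Nat.log 2 t) atTop atTop := by
    refine tendsto_atTop.2 fun b => ?_
    filter_upwards [eventually_ge_atTop (2 ^ b)] with t ht
    exact Nat.le_log_of_pow_le one_lt_two ht
  filter_upwards [hconf, hchain.ae_eventually_lt_length hε,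
    hchain.ae_eventually_energy_lt hinit hε] with ω hω hlow hup
  filter_upwards [hNatLog.eventually hlow, hNatLog.eventually hup,
    hlog.eventually (eventually_two_mul_rpow_le hε), hlog.eventually_ge_atTop 1,
    eventually_ne_atTop 0] with t hlow hup hgrow hL ht
  have hle : 2 ^ Nat.log 2 t ≤ t := Nat.pow_log_le_self 2 ht
  have hlt : t < 2 ^ (Nat.log 2 t + 1) := Nat.lt_pow_succ_log_self one_lt_two t
  have hkL := natLog_succ_le hL
  constructor
  · obtain ⟨s, hs, hlen⟩ := hlow
    refine ⟨s, hs.trans hle, le_trans ?_ hlen.le⟩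
    refine lower_threshold_le hε (Nat.cast_nonneg t) hL ?_ hkL hgrow
    rw [← pow_succ']
    exact_mod_cast hlt.le
  · intro s hs
    refine le_upper_threshold hε hL ?_ hkL hgrow ?_
      (hup s (hs.trans hlt.le)).le
    · exact_mod_cast hle
    · exact_mod_cast (hω s).length_sq_le


end EV
end
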